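/- arXiv:2302.10052 — 2 statements merged into one kernel-verified Lean document; each statement's English description precedes it below -/
import Mathlib

section
/- (Kharchenko's Galois correspondence) Let G be a finite subgroup of GL_m(K) acting on K⟨x_1,…,x_m⟩. Then the map H ↦ K⟨x_1,…,x_m⟩^H is a bijection between the set of subgroups of G and the set of those subalgebras of K⟨x_1,…,x_m⟩ that contain K⟨x_1,…,x_m⟩^G and are free associative algebras. -/
open Matrix

/-- The action of a matrix `g` on the free associative algebra `K⟨x_1,…,x_m⟩` by linear
substitution of the free generators: `x_j ↦ ∑ i, g i j • x_i`. -/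
noncomputable def freeAct (K : Type*) [CommSemiring K] {m : ℕ}
    (g : Matrix (Fin m) (Fin m) K) :
    FreeAlgebra K (Fin m) →ₐ[K] FreeAlgebra K (Fin m) :=
  FreeAlgebra.lift K fun j => ∑ i, g i j • FreeAlgebra.ι K i

/-- The subalgebra of invariants `K⟨x_1,…,x_m⟩^H` of a subgroup `H` of `GL_m(K)`. -/
noncomputable def freeInvariants (K : Type*) [Field K] {m : ℕ}
    (H : Subgroup (GL (Fin m) K)) : Subalgebra K (FreeAlgebra K (Fin m)) :=
  ⨅ g ∈ H, AlgHom.equalizer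
    (freeAct K ((g : GL (Fin m) K) : Matrix (Fin m) (Fin m) K)) (AlgHom.id K _)

namespace FreeAlgebra

variable {K : Type*} [Field K] {X : Type*}

/-- The coefficients of an element of the free algebra with respect to the basis of words. -/
noncomputable def wordCoeff : FreeAlgebra K X ≃ₗ[K] (FreeMonoid X →₀ K) :=
  (equivMonoidAlgebraFreeMonoid (R := K) (X := X)).toLinearEquiv ≪≫ₗ
    MonoidAlgebra.coeffLinearEquiv K

/-- A word, seen as an element of the free algebra. -/
noncomputable def word (w : FreeMonoid X) : FreeAlgebra K X :=
  wordCoeff.symm (Finsupp.single w 1)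

theorem wordCoeff_eq_coeff (f : FreeAlgebra K X) :
    wordCoeff f = (equivMonoidAlgebraFreeMonoid f).coeff := rfl

@[simp] theorem wordCoeff_word (w : FreeMonoid X) :
    wordCoeff (word w : FreeAlgebra K X) = Finsupp.single w 1 := by
  simp [word]

theorem equivMonoidAlgebraFreeMonoid_word (w : FreeMonoid X) :
    equivMonoidAlgebraFreeMonoid (word w : FreeAlgebra K X) = MonoidAlgebra.single w 1 := by
  apply MonoidAlgebra.coeff_injective
  rw [← wordCoeff_eq_coeff]
  simp

@[simp] theorem word_one : (word 1 : FreeAlgebra K X) = 1 := by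
  apply equivMonoidAlgebraFreeMonoid.injective
  rw [equivMonoidAlgebraFreeMonoid_word, map_one, MonoidAlgebra.one_def]

theorem word_mul (v w : FreeMonoid X) : (word (v * w) : FreeAlgebra K X) = word v * word w := by
  apply equivMonoidAlgebraFreeMonoid.injective
  simp [equivMonoidAlgebraFreeMonoid_word, MonoidAlgebra.single_mul_single]

@[simp] theorem word_of (x : X) : (word (FreeMonoid.of x) : FreeAlgebra K X) = ι K x := by
  apply equivMonoidAlgebraFreeMonoid.injective
  rw [equivMonoidAlgebraFreeMonoid_word]
  simp [equivMonoidAlgebraFreeMonoid, MonoidAlgebra.of_apply]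

theorem wordCoeff_algebraMap (c : K) :
    wordCoeff (algebraMap K (FreeAlgebra K X) c) = Finsupp.single 1 c := by
  rw [Algebra.algebraMap_eq_smul_one, map_smul, ← word_one, wordCoeff_word]
  simp

theorem sum_wordCoeff (f : FreeAlgebra K X) :
    ((wordCoeff f).sum fun w c => c • (word w : FreeAlgebra K X)) = f := by
  apply wordCoeff.injective
  rw [map_finsuppSum]
  simp

theorem _root_.FreeMonoid.mul_inj_of_length {v w v' w' : FreeMonoid X} (h : v * w = v' * w')
    (hl : v.length = v'.length) : v = v' ∧ w = w' :=
  List.append_inj h hl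

theorem _root_.FreeMonoid.exists_eq_mul_of_le_length (w : FreeMonoid X) {n : ℕ}
    (hn : n ≤ w.length) : ∃ v v' : FreeMonoid X, w = v * v' ∧ v.length = n :=
  ⟨FreeMonoid.ofList (w.toList.take n), FreeMonoid.ofList (w.toList.drop n),
    (List.take_append_drop n w.toList).symm, by
      simpa [FreeMonoid.length] using hn⟩

theorem exists_mul_of_wordCoeff_mul_ne_zero {f g : FreeAlgebra K X} {w : FreeMonoid X}
    (h : wordCoeff (f * g) w ≠ 0) :
    ∃ a b, a * b = w ∧ wordCoeff f a ≠ 0 ∧ wordCoeff g b ≠ 0 := by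
  classical
  rw [wordCoeff_eq_coeff, map_mul, ← Finsupp.mem_support_iff] at h
  obtain ⟨a, ha, b, hb, hab⟩ := Finset.mem_mul.1 (MonoidAlgebra.support_coeff_mul_subset _ _ h)
  exact ⟨a, b, hab, Finsupp.mem_support_iff.1 ha, Finsupp.mem_support_iff.1 hb⟩

theorem wordCoeff_mul_mul {f g : FreeAlgebra K X} {v w : FreeMonoid X}
    (h : ∀ a b, wordCoeff f a ≠ 0 → wordCoeff g b ≠ 0 → a * b = v * w → a.length = v.length) :
    wordCoeff (f * g) (v * w) = wordCoeff f v * wordCoeff g w := by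
  rw [wordCoeff_eq_coeff, map_mul equivMonoidAlgebraFreeMonoid f g]
  refine MonoidAlgebra.coeff_mul_mul_of_uniqueMul fun a b ha hb hab => ?_
  exact FreeMonoid.mul_inj_of_length hab
    (h a b (Finsupp.mem_support_iff.1 ha) (Finsupp.mem_support_iff.1 hb) hab)

/-- All words occurring in `f` have length at most `d`. -/
def LengthLE (f : FreeAlgebra K X) (d : ℕ) : Prop := ∀ w, wordCoeff f w ≠ 0 → w.length ≤ d

theorem wordCoeff_mul_mul_of_lengthLE {f g : FreeAlgebra K X} {v w : FreeMonoid X}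
    (hf : LengthLE f v.length) (hg : LengthLE g w.length) :
    wordCoeff (f * g) (v * w) = wordCoeff f v * wordCoeff g w := by
  refine wordCoeff_mul_mul fun a b ha hb hab => ?_
  have h1 := hf a ha
  have h2 := hg b hb
  have h3 := congrArg FreeMonoid.length hab
  simp only [FreeMonoid.length_mul] at h3
  omega

theorem exists_lengthLE_of_ne_zero {f : FreeAlgebra K X} (hf : f ≠ 0) :
    ∃ w, wordCoeff f w ≠ 0 ∧ LengthLE f w.length := by
  have : (wordCoeff f).support.Nonempty := by
    rw [Finsupp.support_nonempty_iff]
    simpa using hf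
  obtain ⟨w, hw, hmax⟩ := Finset.exists_max_image _ FreeMonoid.length this
  exact ⟨w, Finsupp.mem_support_iff.1 hw, fun v hv => hmax v (Finsupp.mem_support_iff.2 hv)⟩

theorem LengthLE.mul {f g : FreeAlgebra K X} {d e : ℕ} (hf : LengthLE f d) (hg : LengthLE g e) :
    LengthLE (f * g) (d + e) := by
  intro w hw
  obtain ⟨a, b, rfl, ha, hb⟩ := exists_mul_of_wordCoeff_mul_ne_zero hw
  rw [FreeMonoid.length_mul]
  exact add_le_add (hf a ha) (hg b hb)

/-- Degrees are additive: a left factor of a short product is short. -/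
theorem LengthLE.of_mul {f g : FreeAlgebra K X} {v : FreeMonoid X} {d : ℕ}
    (hg : wordCoeff g v ≠ 0) (hgl : LengthLE g v.length) (h : LengthLE (f * g) (d + v.length)) :
    LengthLE f d := by
  intro w hw
  have hf : f ≠ 0 := by rintro rfl; simp at hw
  obtain ⟨u, hu, hul⟩ := exists_lengthLE_of_ne_zero hf
  have h1 : wordCoeff (f * g) (u * v) ≠ 0 := by
    rw [wordCoeff_mul_mul_of_lengthLE hul hgl]
    exact mul_ne_zero hu hg
  have h2 := h _ h1
  rw [FreeMonoid.length_mul] at h2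
  have := hul w hw
  omega

theorem lengthLE_word (w : FreeMonoid X) : LengthLE (word w : FreeAlgebra K X) w.length := by
  classical
  intro v hv
  rw [wordCoeff_word, Finsupp.single_apply] at hv
  split_ifs at hv with h
  · rw [h]
  · exact absurd rfl hv

theorem LengthLE.mono {f : FreeAlgebra K X} {d e : ℕ} (hf : LengthLE f d) (h : d ≤ e) :
    LengthLE f e := fun w hw => (hf w hw).trans h

theorem eq_algebraMap_of_lengthLE_zero {f : FreeAlgebra K X} (hf : LengthLE f 0) :
    ∃ c, f = algebraMap K _ c := by
  classical
  refine ⟨wordCoeff f 1, wordCoeff.injective ?_⟩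
  rw [wordCoeff_algebraMap]
  ext w
  rw [Finsupp.single_apply]
  split_ifs with h
  · rw [h]
  · by_contra hw
    exact h (FreeMonoid.length_eq_zero.1 (Nat.le_zero.1 (hf w hw))).symm

/-- The only units of a free algebra are the scalars. -/
theorem exists_eq_algebraMap_of_mul_eq_one {f g : FreeAlgebra K X} (h : f * g = 1) :
    ∃ c, f = algebraMap K _ c := by
  have hg : g ≠ 0 := by rintro rfl; simp at h
  obtain ⟨v, hv, hvl⟩ := exists_lengthLE_of_ne_zero hg
  refine eq_algebraMap_of_lengthLE_zero (LengthLE.of_mul hv hvl ?_)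
  rw [h, ← word_one]
  exact (lengthLE_word 1).mono (Nat.zero_le _)

end FreeAlgebra

namespace FreeAlgebra

variable {K : Type*} [Field K] {X : Type*}

/-- If `n' * x * a` is a left multiple of `n` for every `x`, then `a` is a left multiple of `n`,
unless the free algebra is commutative. -/
theorem exists_eq_mul_of_forall_mul_mul [Nontrivial X] {n n' : FreeAlgebra K X} (hn : n ≠ 0)
    (hn' : n' ≠ 0) (a : FreeAlgebra K X) (h : ∀ x, ∃ f, n' * x * a = f * n) :
    ∃ q, a = q * n := by
  obtain ⟨w, hw, hwl⟩ := exists_lengthLE_of_ne_zero hn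
  obtain ⟨v, hv, hvl⟩ := exists_lengthLE_of_ne_zero hn'
  suffices H : ∀ N : ℕ, ∀ a : FreeAlgebra K X, (∀ u, wordCoeff a u ≠ 0 → u.length < N) →
      (∀ x, ∃ f, n' * x * a = f * n) → ∃ q, a = q * n by
    by_cases ha : a = 0
    · exact ⟨0, by simp [ha]⟩
    obtain ⟨u, -, hu⟩ := exists_lengthLE_of_ne_zero ha
    exact H (u.length + 1) a (fun z hz => Nat.lt_succ_of_le (hu z hz)) h
  intro N
  induction N with
  | zero =>
    intro a ha _
    refine ⟨0, ?_⟩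
    rw [zero_mul]
    apply wordCoeff.injective
    ext u
    by_contra hu
    exact absurd (ha u (by simpa using hu)) (by simp)
  | succ N ih =>
    intro a ha h
    by_cases hN : ∃ u, wordCoeff a u ≠ 0 ∧ u.length = N
    swap
    · exact ih a (fun u hu => lt_of_le_of_ne (Nat.lt_succ_iff.1 (ha u hu))
        fun e => hN ⟨u, hu, e⟩) h
    obtain ⟨u, hu, rfl⟩ := hN
    have hul : LengthLE a u.length := fun z hz => Nat.lt_succ_iff.1 (ha z hz)
    rcases le_or_gt w.length u.length with hle | hlt
    · obtain ⟨f, hf⟩ := h 1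
      rw [mul_one] at hf
      have hfl : LengthLE f (v.length + (u.length - w.length)) := by
        refine LengthLE.of_mul hw hwl ?_
        rw [← hf]
        exact (hvl.mul hul).mono (by omega)
      set q : FreeAlgebra K X := (wordCoeff n' v)⁻¹ • wordCoeff.symm
        (Finsupp.comapDomain (fun z => v * z) (wordCoeff f) (mul_right_injective v).injOn) with hq
      have hqc : ∀ z, wordCoeff q z = (wordCoeff n' v)⁻¹ * wordCoeff f (v * z) := by
        intro z
        simp [hq]
      have hql : LengthLE q (u.length - w.length) := by
        intro z hz
        rw [hqc] at hz
        have := hfl _ (right_ne_zero_of_mul hz)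
        rw [FreeMonoid.length_mul] at this
        omega
      obtain ⟨q', hq'⟩ := ih (a - q * n) (fun z hz => by
        have hzl : z.length ≤ u.length := by
          by_contra hlt
          apply hz
          rw [map_sub, Finsupp.sub_apply]
          have h1 : wordCoeff a z = 0 := by
            by_contra h1; exact hlt (hul z h1)
          have h2 : wordCoeff (q * n) z = 0 := by
            by_contra h2; exact hlt (((hql.mul hwl) z h2).trans (by omega))
          rw [h1, h2, sub_zero]
        refine lt_of_le_of_ne hzl fun e => hz ?_
        obtain ⟨z₁, z₂, rfl, hz₁⟩ :=
          z.exists_eq_mul_of_le_length (n := u.length - w.length) (by omega)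
        have hz₂ : z₂.length = w.length := by
          rw [FreeMonoid.length_mul] at e; omega
        have h1 := wordCoeff_mul_mul_of_lengthLE (f := q) (g := n) (v := z₁) (w := z₂)
          (by rwa [hz₁]) (by rwa [hz₂])
        have h2 := wordCoeff_mul_mul_of_lengthLE (f := n') (g := a) (v := v) (w := z₁ * z₂)
          hvl (by rwa [e])
        have h3 := wordCoeff_mul_mul_of_lengthLE (f := f) (g := n) (v := v * z₁) (w := z₂)
          (by rwa [FreeMonoid.length_mul, hz₁]) (by rwa [hz₂])
        rw [hf, ← mul_assoc, h3] at h2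
        rw [map_sub, Finsupp.sub_apply, h1, hqc, sub_eq_zero]
        field_simp
        rw [h2, mul_comm]) (fun x => by
          obtain ⟨f', hf'⟩ := h x
          exact ⟨f' - n' * x * q, by rw [mul_sub, hf', sub_mul]; simp only [mul_assoc]⟩)
      exact ⟨q' + q, by rw [add_mul, ← hq', sub_add_cancel]⟩
    · exfalso
      obtain ⟨x, y, hxy⟩ := exists_pair_ne X
      have hlet : ∀ z z' : X, wordCoeff (n' * word (FreeMonoid.of z) * a)
          (v * (FreeMonoid.of z' * u)) = wordCoeff n' v *
            (wordCoeff (word (FreeMonoid.of z) : FreeAlgebra K X) (FreeMonoid.of z') *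
              wordCoeff a u) := by
        intro z z'
        have hz : LengthLE (word (FreeMonoid.of z) : FreeAlgebra K X)
          (FreeMonoid.of z').length := lengthLE_word (FreeMonoid.of z)
        rw [mul_assoc, wordCoeff_mul_mul_of_lengthLE hvl, wordCoeff_mul_mul_of_lengthLE hz hul]
        rw [FreeMonoid.length_mul]
        exact hz.mul hul
      have hprod : ∀ z, LengthLE (n' * word (FreeMonoid.of z) * a) (v.length + 1 + u.length) :=
        fun z => (hvl.mul (lengthLE_word (FreeMonoid.of z))).mul hul
      have hbig : w.length ≤ v.length + 1 + u.length := by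
        obtain ⟨f, hf⟩ := h (word (FreeMonoid.of x))
        have hf0 : f ≠ 0 := by
          rintro rfl
          have := hlet x x
          rw [hf, zero_mul, wordCoeff_word] at this
          simp [hv, hu] at this
        obtain ⟨t, ht, htl⟩ := exists_lengthLE_of_ne_zero hf0
        have h1 := hprod x (t * w) (by
          rw [hf, wordCoeff_mul_mul_of_lengthLE htl hwl]
          exact mul_ne_zero ht hw)
        rw [FreeMonoid.length_mul] at h1
        omega
      obtain ⟨v₁, v₂, hv₁₂, hv₁⟩ :=
        v.exists_eq_mul_of_le_length (n := v.length + 1 + u.length - w.length) (by omega)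
      have hsplit : ∀ z z' : X, ∃ f : FreeAlgebra K X, wordCoeff f v₁ *
          wordCoeff n (v₂ * (FreeMonoid.of z' * u)) = wordCoeff n' v *
            (wordCoeff (word (FreeMonoid.of z) : FreeAlgebra K X) (FreeMonoid.of z') *
              wordCoeff a u) ∧ n' * word (FreeMonoid.of z) * a = f * n := by
        intro z z'
        obtain ⟨f, hf⟩ := h (word (FreeMonoid.of z))
        have hfl : LengthLE f v₁.length := by
          refine LengthLE.of_mul hw hwl ?_
          rw [← hf]
          exact (hprod z).mono (by omega)
        refine ⟨f, ?_, hf⟩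
        rw [← hlet, hf, hv₁₂, mul_assoc, wordCoeff_mul_mul_of_lengthLE hfl]
        have := congrArg FreeMonoid.length hv₁₂
        refine hwl.mono ?_
        simp only [FreeMonoid.length_mul, FreeMonoid.length_of] at this ⊢
        omega
      obtain ⟨f, hf, hfn⟩ := hsplit x x
      obtain ⟨f', hf', hfn'⟩ := hsplit x y
      obtain ⟨f'', hf'', -⟩ := hsplit y y
      have hff : f = f' := mul_right_cancel₀ hn (hfn.symm.trans hfn')
      subst hff
      have hxy' : FreeMonoid.of x ≠ FreeMonoid.of y := fun e => hxy (FreeMonoid.of_injective e)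
      simp only [wordCoeff_word, Finsupp.single_eq_same, one_mul] at hf hf' hf''
      rw [Finsupp.single_eq_of_ne hxy'.symm, zero_mul, mul_zero] at hf'
      have h1 := left_ne_zero_of_mul (hf.trans_ne (mul_ne_zero hv hu))
      have h2 := right_ne_zero_of_mul (hf''.trans_ne (mul_ne_zero hv hu))
      exact mul_ne_zero h1 h2 hf'

end FreeAlgebra

open scoped TensorProduct

section Sandwich

variable {K T A : Type*} [Field K] [Ring T] [Algebra K T] [Ring A] [Algebra K A]

/-- The action of `T ⊗ Aᵐᵒᵖ` on `T` by multiplication on the left, and by multiplication on the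
right through `φ : A → T`. -/
noncomputable def sandwich (φ : A →ₐ[K] T) : T ⊗[K] Aᵐᵒᵖ →ₐ[K] Module.End K T :=
  (AlgHom.mulLeftRight K T).comp (Algebra.TensorProduct.map (AlgHom.id K T) φ.op)

@[simp] theorem sandwich_tmul (φ : A →ₐ[K] T) (x : T) (a : Aᵐᵒᵖ) (p : T) :
    sandwich φ (x ⊗ₜ a) p = x * p * φ a.unop := by
  simp [sandwich, AlgHom.mulLeftRight_apply]

/-- `φ` can be separated from `ψ` by elements of `T ⊗ Aᵐᵒᵖ`. -/
def Separates (φ ψ : A →ₐ[K] T) : Prop :=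
  ∀ u q : T, q ≠ 0 → ∃ s, sandwich ψ s u = 0 ∧ sandwich φ s q ≠ 0

theorem Separates.exists_isolating {φ : A →ₐ[K] T} (L : List ((A →ₐ[K] T) × T))
    (hL : ∀ x ∈ L, Separates φ x.1) {p : T} (hp : p ≠ 0) :
    ∃ s, (∀ x ∈ L, sandwich x.1 s x.2 = 0) ∧ sandwich φ s p ≠ 0 := by
  induction L with
  | nil => exact ⟨1, by simp, by simpa using hp⟩
  | cons x L ih =>
    obtain ⟨s, hs, hsp⟩ := ih fun y hy => hL y (List.mem_cons_of_mem _ hy)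
    obtain ⟨t, ht, htp⟩ := hL x List.mem_cons_self (sandwich x.1 s x.2) _ hsp
    refine ⟨t * s, fun y hy => ?_, by simpa using htp⟩
    rcases List.mem_cons.1 hy with rfl | hy
    · simpa using ht
    · simp [hs y hy]

theorem Separates.of_commute [IsDomain T] (hT : ∀ x y : T, x * y = y * x) {φ ψ : A →ₐ[K] T}
    (h : φ ≠ ψ) : Separates φ ψ := by
  obtain ⟨a, ha⟩ := DFunLike.ne_iff.1 h
  intro u q hq
  refine ⟨ψ a ⊗ₜ 1 - 1 ⊗ₜ MulOpposite.op a, ?_, ?_⟩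
  · simp [hT u]
  · simp only [map_sub, LinearMap.sub_apply, sandwich_tmul, MulOpposite.unop_one, map_one, mul_one,
      one_mul, MulOpposite.unop_op, hT q, ← sub_mul]
    exact mul_ne_zero (sub_ne_zero.2 ha.symm) hq

theorem AlgHom.eq_of_forall_eq_smul [Nontrivial T] {φ ψ : A →ₐ[K] T}
    (h : ∀ a, ∃ c : K, φ a = c • ψ a) : φ = ψ := by
  ext a
  obtain ⟨c, hc⟩ := h a
  obtain ⟨d, hd⟩ := h (a + 1)
  rw [map_add, map_add, map_one, map_one, hc, smul_add] at hd
  by_cases hcd : c = d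
  · subst hcd
    have h1 : (1 : T) = c • 1 := add_left_cancel hd
    have h2 : c = 1 := by
      rw [← Algebra.algebraMap_eq_smul_one, ← map_one (algebraMap K T)] at h1
      exact ((algebraMap K T).injective h1).symm
    rw [hc, h2, one_smul]
  · have h1 : (c - d) • ψ a = (d - 1) • 1 := by
      rw [sub_smul, sub_smul, one_smul, sub_eq_sub_iff_add_eq_add, hd, add_comm]
    have h2 : ψ a = algebraMap K T ((c - d)⁻¹ * (d - 1)) := by
      rw [Algebra.algebraMap_eq_smul_one, mul_smul, ← h1, inv_smul_smul₀ (sub_ne_zero.2 hcd)]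
    have h3 : ψ (a - algebraMap K A ((c - d)⁻¹ * (d - 1))) = 0 := by
      rw [map_sub, h2, AlgHom.commutes, sub_self]
    obtain ⟨e, he⟩ := h (a - algebraMap K A ((c - d)⁻¹ * (d - 1)))
    rw [h3, smul_zero, map_sub, AlgHom.commutes, sub_eq_zero] at he
    rw [he, h2]

end Sandwich

/-- The properties of noncommutative free algebras on which the Galois correspondence rests. -/
structure IsRigid (K T : Type*) [Field K] [Ring T] [Algebra K T] : Prop where
  exists_eq_mul : ∀ {n n' : T}, n ≠ 0 → n' ≠ 0 → ∀ a, (∀ x, ∃ f, n' * x * a = f * n) →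
    ∃ q, a = q * n
  eq_algebraMap_of_mul_eq_one : ∀ {f g : T}, f * g = 1 → ∃ c, f = algebraMap K T c
  exists_ne_algebraMap : ∃ t : T, ∀ c, t ≠ algebraMap K T c

theorem FreeAlgebra.isRigid {K X : Type*} [Field K] [Nontrivial X] :
    IsRigid K (FreeAlgebra K X) where
  exists_eq_mul := FreeAlgebra.exists_eq_mul_of_forall_mul_mul
  eq_algebraMap_of_mul_eq_one := FreeAlgebra.exists_eq_algebraMap_of_mul_eq_one
  exists_ne_algebraMap :=
    ⟨FreeAlgebra.ι K (Classical.arbitrary X), FreeAlgebra.ι_ne_algebraMap _⟩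

section Galois

variable {K T : Type*} [Field K] [Ring T] [Algebra K T]

variable {Γ : Type*} [Group Γ] (α : Γ →* (T ≃ₐ[K] T))

/-- The restriction of `α g` to a subalgebra. -/
def galoisRestrict (A : Subalgebra K T) (g : Γ) : A →ₐ[K] T := (α g : T →ₐ[K] T).comp A.val

@[simp] theorem galoisRestrict_apply (A : Subalgebra K T) (g : Γ) (a : A) :
    galoisRestrict α A g a = α g a := rfl

section Trace

variable [Fintype Γ]

/-- The sum over the group. -/
def galoisTrace : T →ₗ[K] T := ∑ g, (α g).toLinearMap

theorem galoisTrace_apply (x : T) : galoisTrace α x = ∑ g, α g x := by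
  simp [galoisTrace]

theorem apply_galoisTrace (k : Γ) (x : T) : α k (galoisTrace α x) = galoisTrace α x := by
  simp only [galoisTrace_apply, map_sum]
  exact Fintype.sum_equiv (Equiv.mulLeft k) _ _ fun g => by simp

end Trace

variable [IsDomain T]

theorem IsRigid.eq_smul_and_eq_of_forall (hT : IsRigid K T) (k : T ≃ₐ[K] T) {u q : T}
    (hu : u ≠ 0) (hq : q ≠ 0) (h : ∀ s, u * s * q = q * k s * k u) :
    (∃ c : K, q = c • u) ∧ ∀ s, k s = s := by
  have hku : k u ≠ 0 := (map_ne_zero_iff k k.injective).2 hu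
  obtain ⟨y, hy⟩ := hT.exists_eq_mul hq hq (k u) fun x => ⟨u * k.symm x, by simp [h]⟩
  obtain ⟨z, hz⟩ := hT.exists_eq_mul hku hu q fun x => ⟨q * k x, h x⟩
  obtain ⟨c, rfl⟩ := hT.eq_algebraMap_of_mul_eq_one (f := y) (g := z) (by
    apply mul_right_cancel₀ hku
    rw [mul_assoc, ← hz, ← hy, one_mul])
  have hs : ∀ s, u * s = c • (q * k s) := fun s => by
    apply mul_right_cancel₀ hq
    rw [h, hy, ← Algebra.smul_def, mul_smul_comm, smul_mul_assoc]
  have huq : u = c • q := by simpa using hs 1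
  have hc : c ≠ 0 := by
    rintro rfl
    exact hu (by simpa using huq)
  refine ⟨⟨c⁻¹, by rw [huq, inv_smul_smul₀ hc]⟩, fun s => ?_⟩
  have h1 := hs s
  rw [huq, smul_mul_assoc] at h1
  exact (mul_left_cancel₀ hq (smul_right_injective T hc h1)).symm

theorem IsRigid.eq_and_eq_smul (hT : IsRigid K T) (hα : Function.Injective α) {g h : Γ} {u q : T}
    (hu : u ≠ 0) (hq : q ≠ 0)
    (H : ∀ s, sandwich (α h : T →ₐ[K] T) s u = 0 → sandwich (α g : T →ₐ[K] T) s q = 0) :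
    g = h ∧ ∃ c : K, q = c • u := by
  have key : ∀ s, u * s * q = q * α (g * h⁻¹) s * α (g * h⁻¹) u := fun s => by
    have h1 := H ((u * s) ⊗ₜ 1 - 1 ⊗ₜ MulOpposite.op (α h⁻¹ s * α h⁻¹ u)) (by
      simp [mul_assoc])
    simpa [sub_eq_zero, mul_assoc] using h1
  obtain ⟨hc, hs⟩ := hT.eq_smul_and_eq_of_forall _ hu hq key
  refine ⟨?_, hc⟩
  rw [← mul_inv_eq_one]
  apply hα
  rw [map_one]
  ext s
  exact hs s

theorem IsRigid.separates_one (hT : IsRigid K T) (hα : Function.Injective α) (g : Γ)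
    (hg : g ≠ 1) : Separates (α 1 : T →ₐ[K] T) (α g : T →ₐ[K] T) := by
  intro u q hq
  by_contra! H
  have hu : u ≠ 0 := by
    rintro rfl
    exact hq (by simpa using H 1 (by simp))
  exact hg (hT.eq_and_eq_smul α hα hu hq H).1.symm

variable [Fintype Γ]

theorem IsRigid.exists_isolating_pair (hT : IsRigid K T) (hα : Function.Injective α) {u q : T}
    (huq : ∀ c : K, q ≠ c • u) :
    ∃ s : T ⊗[K] Tᵐᵒᵖ, (∀ g, sandwich (α g : T →ₐ[K] T) s u = 0) ∧
      (∀ g ≠ 1, sandwich (α g : T →ₐ[K] T) s q = 0) ∧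
      sandwich (α 1 : T →ₐ[K] T) s q ≠ 0 := by
  classical
  have hsep := hT.separates_one α hα
  -- elements acting through the identity coordinate only
  set I : Set (T ⊗[K] Tᵐᵒᵖ) := {s | ∀ g ≠ 1, sandwich (α g : T →ₐ[K] T) s u = 0 ∧
    sandwich (α g : T →ₐ[K] T) s q = 0}
  have hI : ∀ p ≠ 0, ∃ s ∈ I, sandwich (α 1 : T →ₐ[K] T) s p ≠ 0 := by
    intro p hp
    obtain ⟨s, hs, hsp⟩ := Separates.exists_isolating
      ((Finset.univ.filter (· ≠ (1 : Γ))).toList.flatMap fun g =>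
        [((α g : T →ₐ[K] T), u), ((α g : T →ₐ[K] T), q)]) (φ := (α 1 : T →ₐ[K] T)) (by
          intro x hx
          simp only [List.mem_flatMap, Finset.mem_toList, Finset.mem_filter, List.mem_cons] at hx
          obtain ⟨g, hg, rfl | rfl | hx⟩ := hx
          · exact hsep g hg.2
          · exact hsep g hg.2
          · simp at hx) hp
    have hmem : ∀ g ≠ (1 : Γ), g ∈ (Finset.univ.filter (· ≠ (1 : Γ))).toList := by simp
    exact ⟨s, fun g hg => ⟨hs (_, u) (List.mem_flatMap.2 ⟨g, hmem g hg, List.mem_cons_self⟩),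
      hs (_, q) (List.mem_flatMap.2 ⟨g, hmem g hg, List.mem_cons_of_mem _ List.mem_cons_self⟩)⟩,
      hsp⟩
  have hmul : ∀ t, ∀ s ∈ I, t * s ∈ I := fun t s hs g hg => by
    simp [hs g hg]
  have hadd : ∀ s ∈ I, ∀ t ∈ I, s + t ∈ I := fun s hs t ht g hg => by
    simp [hs g hg, ht g hg]
  by_contra! hcon
  have hker : ∀ s ∈ I, sandwich (α 1 : T →ₐ[K] T) s u = 0 →
      sandwich (α 1 : T →ₐ[K] T) s q = 0 := fun s hs hsu => by
    refine hcon s (fun g => ?_) fun g hg => (hs g hg).2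
    by_cases hg : g = 1
    · rwa [hg]
    · exact (hs g hg).1
  have hprop : ∀ s ∈ I, ∃ c : K,
      sandwich (α 1 : T →ₐ[K] T) s q = c • sandwich (α 1 : T →ₐ[K] T) s u := by
    intro s hs
    by_cases hq : sandwich (α 1 : T →ₐ[K] T) s q = 0
    · exact ⟨0, by rw [hq, zero_smul]⟩
    have hu : sandwich (α 1 : T →ₐ[K] T) s u ≠ 0 := fun hu => hq (hker s hs hu)
    refine (hT.eq_and_eq_smul α hα (g := 1) (h := 1) hu hq fun t ht => ?_).2
    simpa using hker (t * s) (hmul t s hs) (by simpa using ht)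
  obtain ⟨s, hs, hsq⟩ := hI q (by simpa using huq 0)
  obtain ⟨c, hc⟩ := hprop s hs
  obtain ⟨s', hs', hsq'⟩ := hI (q - c • u) (sub_ne_zero.2 (huq c))
  obtain ⟨c', hc'⟩ := hprop s' hs'
  set v := sandwich (α 1 : T →ₐ[K] T) s u
  set v' := sandwich (α 1 : T →ₐ[K] T) s' u
  have hv : v ≠ 0 := by
    intro hv
    exact hsq (by rw [hc, hv, smul_zero])
  rw [map_sub, hc', map_smul, ← sub_smul] at hsq'
  have hcc : c' - c ≠ 0 := left_ne_zero_of_smul hsq'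
  have hv' : v' ≠ 0 := right_ne_zero_of_smul hsq'
  have hx : ∀ x : T, ∃ d : K, x * v = d • v' := by
    intro x
    obtain ⟨e, he⟩ := hprop (x ⊗ₜ 1 * s + s') (hadd _ (hmul _ _ hs) _ hs')
    have he' : c • (x * v) + c' • v' = e • (x * v) + e • v' := by
      simpa only [map_add, map_mul, LinearMap.add_apply, Module.End.mul_apply, sandwich_tmul,
        MulOpposite.unop_one, map_one (α 1 : T →ₐ[K] T), mul_one, smul_add, hc, hc',
        mul_smul_comm] using he
    have h1 : (c - e) • (x * v) = (e - c') • v' := by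
      rw [sub_smul, sub_smul, sub_eq_sub_iff_add_eq_add, he', add_comm]
    by_cases hce : c = e
    · subst hce
      rw [sub_self, zero_smul] at h1
      exact absurd h1.symm (smul_ne_zero (by rwa [← neg_sub, neg_ne_zero]) hv')
    · exact ⟨(c - e)⁻¹ * (e - c'), by
        rw [mul_smul, ← h1, inv_smul_smul₀ (sub_ne_zero.2 hce)]⟩
  obtain ⟨t, ht⟩ := hT.exists_ne_algebraMap
  obtain ⟨d, hd⟩ := hx 1
  obtain ⟨e, he⟩ := hx t
  rw [one_mul] at hd
  have hd0 : d ≠ 0 := by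
    rintro rfl
    exact hv (by rw [hd, zero_smul])
  refine ht (e * d⁻¹) (mul_right_cancel₀ hv ?_)
  rw [he, ← Algebra.smul_def, hd, smul_smul, mul_assoc, inv_mul_cancel₀ hd0, mul_one]

end Galois

section GaloisSubalgebra

variable {K T : Type*} [Field K] [Ring T] [Algebra K T] [IsDomain T]
  {Γ : Type*} [Group Γ] [Fintype Γ] (α : Γ →* (T ≃ₐ[K] T))

theorem exists_isolating_one (hα : ∀ g ≠ 1, Separates (α 1 : T →ₐ[K] T) (α g : T →ₐ[K] T)) :
    ∃ s : T ⊗[K] Tᵐᵒᵖ, (∀ g ≠ 1, sandwich (α g : T →ₐ[K] T) s 1 = 0) ∧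
      sandwich (α 1 : T →ₐ[K] T) s 1 ≠ 0 := by
  classical
  obtain ⟨s, hs, hs1⟩ := Separates.exists_isolating
    ((Finset.univ.filter (· ≠ (1 : Γ))).toList.map fun g => ((α g : T →ₐ[K] T), (1 : T)))
    (φ := (α 1 : T →ₐ[K] T)) (by
      intro x hx
      obtain ⟨g, hg, rfl⟩ := List.mem_map.1 hx
      exact hα g (by simpa using hg)) one_ne_zero
  exact ⟨s, fun g hg => hs (_, 1) (List.mem_map.2 ⟨g, by simpa using hg, rfl⟩), hs1⟩

/-- A group element fixing every invariant of a subgroup lies in the subgroup. -/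
theorem mem_of_forall_invariant
    (hα : ∀ g ≠ 1, Separates (α 1 : T →ₐ[K] T) (α g : T →ₐ[K] T)) (H : Subgroup Γ) {g : Γ}
    (hg : ∀ x, (∀ h ∈ H, α h x = x) → α g x = x) : g ∈ H := by
  classical
  cases nonempty_fintype H
  by_contra hgH
  obtain ⟨s, hs, hs1⟩ := exists_isolating_one α hα
  have key : ∀ s : T ⊗[K] Tᵐᵒᵖ, ∑ h : H, sandwich (α (g * h) : T →ₐ[K] T) s 1 =
      ∑ h : H, sandwich (α h : T →ₐ[K] T) s 1 := by
    intro s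
    induction s with
    | zero => simp
    | add s t hs ht => simp only [map_add, LinearMap.add_apply, Finset.sum_add_distrib, hs, ht]
    | tmul x y =>
      have h1 := hg (galoisTrace (α.comp H.subtype) y.unop) fun h hh =>
        apply_galoisTrace (α.comp H.subtype) ⟨h, hh⟩ _
      simp only [galoisTrace_apply, map_sum] at h1
      simpa [← Finset.mul_sum] using congrArg (x * ·) h1
  apply hs1
  have h1 := key s
  rw [Finset.sum_eq_zero fun (h : H) _ => hs (g * h) fun h2 => hgH (by
    rw [mul_eq_one_iff_eq_inv.1 h2]
    exact H.inv_mem h.2)] at h1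
  rw [Finset.sum_eq_single 1 (fun (h : H) _ hh => hs h (by simpa using hh)) (by simp)] at h1
  exact h1.symm

/-- Up to right multiplication by one nonzero element, a subalgebra containing all traces contains
the invariants of its pointwise stabilizer. -/
theorem exists_forall_mul_mem
    (hα : ∀ g ≠ 1, Separates (α 1 : T →ₐ[K] T) (α g : T →ₐ[K] T)) {A : Subalgebra K T}
    (hA : ∀ x, galoisTrace α x ∈ A)
    (hsep : ∀ g, galoisRestrict α A 1 ≠ galoisRestrict α A g →
      Separates (galoisRestrict α A 1) (galoisRestrict α A g))
    (H : Subgroup Γ) (hH : ∀ g, g ∈ H ↔ ∀ a ∈ A, α g a = a) :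
    ∃ c ∈ A, c ≠ 0 ∧ ∀ r, (∀ h ∈ H, α h r = r) → r * c ∈ A := by
  classical
  have hres : ∀ g, g ∈ H ↔ galoisRestrict α A 1 = galoisRestrict α A g := fun g => by
    rw [hH, DFunLike.ext_iff]
    simp [eq_comm]
  obtain ⟨s, hs, hs1⟩ := Separates.exists_isolating
    ((Finset.univ.filter (· ∉ H)).toList.map fun g => (galoisRestrict α A g, (1 : T)))
    (φ := galoisRestrict α A 1) (by
      intro x hx
      obtain ⟨g, hg, rfl⟩ := List.mem_map.1 hx
      exact hsep g (by simpa [hres] using hg)) one_ne_zero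
  set c := sandwich (galoisRestrict α A 1) s 1
  have hsc : ∀ g, sandwich (galoisRestrict α A g) s 1 = if g ∈ H then c else 0 := fun g => by
    split_ifs with hg
    · rw [← (hres g).1 hg]
    · exact hs (_, 1) (List.mem_map.2 ⟨g, by simpa using hg, rfl⟩)
  have htr : ∀ (s : T ⊗[K] Aᵐᵒᵖ) (w : T),
      ∑ g, α g (w * sandwich (galoisRestrict α A g⁻¹) s 1) ∈ A := by
    intro s w
    induction s with
    | zero => simp
    | add s t hs ht =>
      simp only [map_add, LinearMap.add_apply, mul_add, Finset.sum_add_distrib]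
      exact A.add_mem hs ht
    | tmul x y =>
      have := A.mul_mem (hA (w * x)) y.unop.2
      simpa [galoisTrace_apply, Finset.sum_mul, mul_assoc] using this
  have htrH : ∀ w, galoisTrace (α.comp H.subtype) (w * c) ∈ A := fun w => by
    have h1 := htr s w
    simp only [hsc, H.inv_mem_iff, mul_ite, mul_zero, apply_ite (α _), map_zero] at h1
    rw [← Finset.sum_filter, Finset.sum_subtype (p := (· ∈ H)) _ (by simp)] at h1
    rw [galoisTrace_apply]
    exact h1
  obtain ⟨z, hz⟩ : ∃ z, galoisTrace (α.comp H.subtype) (z * c) ≠ 0 := by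
    by_contra! hz
    obtain ⟨s', hs', hs1'⟩ := exists_isolating_one α hα
    have key : ∀ s : T ⊗[K] Tᵐᵒᵖ, ∑ h : H, sandwich (α h : T →ₐ[K] T) s 1 * α h c = 0 := by
      intro s
      induction s with
      | zero => simp
      | add s t hs ht =>
        simp only [map_add, LinearMap.add_apply, Finset.sum_add_distrib, add_mul, hs, ht, add_zero]
      | tmul x y =>
        have h1 := hz y.unop
        rw [galoisTrace_apply] at h1
        simpa [← Finset.mul_sum, mul_assoc] using congrArg (x * ·) h1
    have h1 := key s'
    rw [Finset.sum_eq_single 1 (fun h _ hh => by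
      rw [hs' h (by simpa using hh), zero_mul]) (by simp)] at h1
    exact mul_ne_zero hs1' (by simpa using hs1) h1
  refine ⟨_, htrH z, hz, fun r hr => ?_⟩
  have h1 := htrH (r * z)
  have h2 : ∀ h : H, α h r = r := fun h => hr h h.2
  simpa [galoisTrace_apply, mul_assoc, Finset.mul_sum, h2] using h1

variable {α}

theorem IsRigid.exists_sandwich_galoisRestrict (hT : IsRigid K T)
    (hα : Function.Injective α) {A : Subalgebra K T} (hA : ∀ x, galoisTrace α x ∈ A) {u q : T}
    (huq : ∀ c : K, q ≠ c • u) :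
    ∃ s, ∀ g, sandwich (galoisRestrict α A g) s u = 0 ∧
      sandwich (galoisRestrict α A g) s q ≠ 0 := by
  classical
  have key : ∀ s : T ⊗[K] Tᵐᵒᵖ, ∃ s' : T ⊗[K] Aᵐᵒᵖ, ∀ g p,
      sandwich (galoisRestrict α A g) s' p = ∑ k, sandwich (α k : T →ₐ[K] T) s p := by
    intro s
    induction s with
    | zero => exact ⟨0, by simp⟩
    | add s t hs ht =>
      obtain ⟨s', hs'⟩ := hs
      obtain ⟨t', ht'⟩ := ht
      exact ⟨s' + t', by simp [hs', ht', Finset.sum_add_distrib]⟩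
    | tmul x y =>
      refine ⟨x ⊗ₜ MulOpposite.op ⟨galoisTrace α y.unop, hA _⟩, fun g p => ?_⟩
      simp only [sandwich_tmul, MulOpposite.unop_op, galoisRestrict_apply, apply_galoisTrace]
      simp [galoisTrace_apply, Finset.mul_sum]
  obtain ⟨s, hu, hq, hq1⟩ := hT.exists_isolating_pair α hα huq
  obtain ⟨s', hs'⟩ := key s
  refine ⟨s', fun g => ⟨?_, ?_⟩⟩
  · rw [hs', Finset.sum_eq_zero fun k _ => hu k]
  · rwa [hs', Finset.sum_eq_single 1 (fun k _ hk => hq k hk) (by simp)]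

theorem IsRigid.separates_galoisRestrict (hT : IsRigid K T)
    (hα : Function.Injective α) {A : Subalgebra K T} (hA : ∀ x, galoisTrace α x ∈ A) {g k : Γ}
    (hgk : galoisRestrict α A g ≠ galoisRestrict α A k) :
    Separates (galoisRestrict α A g) (galoisRestrict α A k) := by
  intro u q hq
  by_contra! h
  have hprop : ∀ a, ∃ c : K, q * galoisRestrict α A g a = c • (u * galoisRestrict α A k a) := by
    intro a
    by_contra! hc
    obtain ⟨s, hs⟩ := hT.exists_sandwich_galoisRestrict hα hA hc
    apply (hs g).2
    have h1 := h (s * 1 ⊗ₜ MulOpposite.op a) (by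
      rw [map_mul, Module.End.mul_apply, sandwich_tmul, one_mul, MulOpposite.unop_op, (hs k).1])
    rwa [map_mul, Module.End.mul_apply, sandwich_tmul, one_mul, MulOpposite.unop_op] at h1
  obtain ⟨c, hc⟩ := hprop 1
  rw [map_one, map_one, mul_one, mul_one] at hc
  have hc0 : c ≠ 0 := by
    rintro rfl
    exact hq (by rw [hc, zero_smul])
  have hu : u ≠ 0 := by
    rintro rfl
    exact hq (by rw [hc, smul_zero])
  refine hgk (AlgHom.eq_of_forall_eq_smul fun a => ?_)
  obtain ⟨d, hd⟩ := hprop a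
  refine ⟨c⁻¹ * d, mul_left_cancel₀ hu ?_⟩
  rw [hc, smul_mul_assoc] at hd
  rw [mul_smul_comm, mul_smul, ← hd, inv_smul_smul₀ hc0]

/-- A subalgebra containing all traces is not commutative. -/
theorem IsRigid.exists_mul_ne_mul (hT : IsRigid K T)
    (hα : Function.Injective α) {A : Subalgebra K T} (hA : ∀ x, galoisTrace α x ∈ A) :
    ∃ a ∈ A, ∃ b ∈ A, a * b ≠ b * a := by
  by_contra! hcomm
  obtain ⟨t, ht, htA⟩ : ∃ t : T, (∀ c, t ≠ algebraMap K T c) ∧ ∀ a ∈ A, t * a = a * t := by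
    by_cases h : ∃ b ∈ A, ∀ c, b ≠ algebraMap K T c
    · obtain ⟨b, hb, hbc⟩ := h
      exact ⟨b, hbc, fun a ha => hcomm b hb a ha⟩
    · push Not at h
      obtain ⟨t, ht⟩ := hT.exists_ne_algebraMap
      refine ⟨t, ht, fun a ha => ?_⟩
      obtain ⟨c, rfl⟩ := h a ha
      exact (Algebra.commutes c t).symm
  obtain ⟨s, hs⟩ := hT.exists_sandwich_galoisRestrict hα hA (u := 1) (q := t) fun c => by
    rw [← Algebra.algebraMap_eq_smul_one]
    exact ht c
  have key : ∀ s, sandwich (galoisRestrict α A 1) s t =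
      sandwich (galoisRestrict α A 1) s 1 * t := by
    intro s
    induction s with
    | zero => simp
    | add s t hs ht => simp [hs, ht, add_mul]
    | tmul x y => simp [mul_assoc, htA]
  exact (hs 1).2 (by rw [key, (hs 1).1, zero_mul])

end GaloisSubalgebra

section FreeSubalgebra

variable {K : Type*} [Field K]

theorem FreeAlgebra.mul_comm_of_subsingleton {X : Type*} [Subsingleton X] (f g : FreeAlgebra K X) :
    f * g = g * f := by
  induction f using FreeAlgebra.induction with
  | grade0 r => exact Algebra.commutes r g
  | mul f f' hf hf' => rw [mul_assoc, hf', ← mul_assoc, hf, mul_assoc]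
  | add f f' hf hf' => rw [add_mul, mul_add, hf, hf']
  | grade1 x =>
    induction g using FreeAlgebra.induction with
    | grade0 r => exact (Algebra.commutes r _).symm
    | mul f f' hf hf' => rw [mul_assoc, ← hf', ← mul_assoc, hf, mul_assoc]
    | add f f' hf hf' => rw [add_mul, mul_add, hf, hf']
    | grade1 y => rw [Subsingleton.elim x y]

theorem FreeAlgebra.subsingleton_of_mul_comm {X : Type*}
    (h : ∀ f g : FreeAlgebra K X, f * g = g * f) : Subsingleton X := by
  classical
  refine ⟨fun x y => ?_⟩
  have h1 := h (word (FreeMonoid.of x)) (word (FreeMonoid.of y))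
  rw [← word_mul, ← word_mul] at h1
  have h2 := congrArg wordCoeff h1
  rw [wordCoeff_word, wordCoeff_word] at h2
  have h3 := Finsupp.single_left_injective (one_ne_zero' K) h2
  have h4 : [x, y] = [y, x] := h3
  simpa using (List.cons.inj h4).1

open Polynomial in
theorem Polynomial.exists_comp_eq_X {p c : K[X]} (hc : c ≠ 0)
    (h : ∀ f : K[X], ∃ g : K[X], f * c = g.comp p) : ∃ q : K[X], q.comp p = X := by
  obtain ⟨g, hg⟩ := h 1
  obtain ⟨g', hg'⟩ := h X
  have h1 := congrArg natDegree hg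
  have h2 := congrArg natDegree hg'
  rw [one_mul, natDegree_comp] at h1
  rw [natDegree_X_mul hc, natDegree_comp, h1] at h2
  have h3 : p.natDegree = 1 := Nat.dvd_one.1 ((Nat.dvd_add_right (Dvd.intro_left _ rfl)).1
    (h2 ▸ Dvd.intro_left _ rfl))
  obtain ⟨a, ha, b, rfl⟩ := natDegree_eq_one.1 h3
  refine ⟨C a⁻¹ * (X - C b), ?_⟩
  rw [mul_comp, C_comp, sub_comp, X_comp, C_comp, add_sub_cancel_right, ← mul_assoc, ← C_mul,
    inv_mul_cancel₀ ha, C_1, one_mul]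

/-- The free algebra on one generator is the polynomial ring. -/
noncomputable def FreeAlgebra.equivPolynomial (K X : Type*) [Field K] [Unique X] :
    FreeAlgebra K X ≃ₐ[K] Polynomial K :=
  AlgEquiv.ofAlgHom (FreeAlgebra.lift K fun _ => Polynomial.X)
    (Polynomial.aeval (FreeAlgebra.ι K default)) (by ext; simp)
    (by ext x; simp [Unique.eq_default x])

theorem FreeAlgebra.exists_eq_algebraMap {X : Type*} [IsEmpty X] (f : FreeAlgebra K X) :
    ∃ c, f = algebraMap K _ c := by
  induction f using FreeAlgebra.induction with
  | grade0 r => exact ⟨r, rfl⟩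
  | grade1 x => exact isEmptyElim x
  | mul f g hf hg =>
    obtain ⟨⟨c, rfl⟩, ⟨d, rfl⟩⟩ := And.intro hf hg
    exact ⟨c * d, by simp⟩
  | add f g hf hg =>
    obtain ⟨⟨c, rfl⟩, ⟨d, rfl⟩⟩ := And.intro hf hg
    exact ⟨c + d, by simp⟩

variable {T : Type*} [Ring T] [Algebra K T]

theorem Subalgebra.exists_eq_algebraMap_of_isEmpty {X : Type*} [IsEmpty X] {A : Subalgebra K T}
    (e : A ≃ₐ[K] FreeAlgebra K X) {a : T} (ha : a ∈ A) : ∃ c, a = algebraMap K T c := by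
  obtain ⟨c, hc⟩ := FreeAlgebra.exists_eq_algebraMap (e ⟨a, ha⟩)
  refine ⟨c, ?_⟩
  have h1 := congrArg (fun z => ((e.symm z : A) : T)) hc
  simpa using h1

/-- A noncommutative free subalgebra contains every larger subalgebra which it contains up to
multiplication by nonzero elements on either side. -/
theorem Subalgebra.le_of_free_of_nontrivial [IsDomain T] {X : Type*} [Nontrivial X]
    {A C : Subalgebra K T} (e : A ≃ₐ[K] FreeAlgebra K X) (hAC : A ≤ C) {n n' : T} (hn : n ∈ A)
    (hn0 : n ≠ 0) (hn' : n' ∈ A) (hn0' : n' ≠ 0) (h : ∀ r ∈ C, r * n ∈ A)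
    (h' : ∀ r ∈ C, n' * r ∈ A) :
    C ≤ A := by
  intro r hr
  have hne : ∀ {x : T} (hx : x ∈ A), x ≠ 0 → e ⟨x, hx⟩ ≠ 0 := fun hx hx0 => by
    rw [map_ne_zero_iff e e.injective]
    exact fun h0 => hx0 (congrArg Subtype.val h0)
  obtain ⟨q, hq⟩ := FreeAlgebra.exists_eq_mul_of_forall_mul_mul (hne hn hn0) (hne hn' hn0')
    (e ⟨r * n, h r hr⟩) fun x => by
      refine ⟨e ⟨n' * (e.symm x * r), h' _ (C.mul_mem (hAC (e.symm x).2) hr)⟩, ?_⟩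
      apply e.symm.injective
      simp only [map_mul, AlgEquiv.symm_apply_apply]
      ext
      simp [mul_assoc]
  have h1 := congrArg (fun z => ((e.symm z : A) : T)) hq
  simp only [map_mul, AlgEquiv.symm_apply_apply, MulMemClass.coe_mul] at h1
  rw [mul_right_cancel₀ hn0 h1]
  exact (e.symm q).2

/-- The commutative counterpart of `Subalgebra.le_of_free_of_nontrivial`. -/
theorem Subalgebra.le_of_free_of_commute (hT : ∀ x y : T, x * y = y * x) {X Y : Type*}
    {A C : Subalgebra K T} (e : A ≃ₐ[K] FreeAlgebra K X) (f : C ≃ₐ[K] FreeAlgebra K Y)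
    (hAC : A ≤ C) {n : T} (hn : n ∈ A) (hn0 : n ≠ 0) (h : ∀ r ∈ C, r * n ∈ A) : C ≤ A := by
  have hcomm : ∀ (D : Subalgebra K T) (x y : D), x * y = y * x := fun D x y =>
    Subtype.ext (hT x y)
  have hX : Subsingleton X := FreeAlgebra.subsingleton_of_mul_comm (K := K) fun x y => by
    simpa using congrArg e (hcomm A (e.symm x) (e.symm y))
  have hY : Subsingleton Y := FreeAlgebra.subsingleton_of_mul_comm (K := K) fun x y => by
    simpa using congrArg f (hcomm C (f.symm x) (f.symm y))
  intro r hr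
  rcases isEmpty_or_nonempty X with hX0 | ⟨⟨x⟩⟩
  · obtain ⟨c, rfl⟩ := Subalgebra.exists_eq_algebraMap_of_isEmpty e hn
    have hc : c ≠ 0 := by
      rintro rfl
      exact hn0 (map_zero _)
    have h1 := A.smul_mem (h r hr) c⁻¹
    rwa [hT, ← Algebra.smul_def, inv_smul_smul₀ hc] at h1
  rcases isEmpty_or_nonempty Y with hY0 | ⟨⟨y⟩⟩
  · obtain ⟨c, rfl⟩ := Subalgebra.exists_eq_algebraMap_of_isEmpty f hr
    exact A.algebraMap_mem c
  have := uniqueOfSubsingleton x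
  have := uniqueOfSubsingleton y
  let e' := e.trans (FreeAlgebra.equivPolynomial K X)
  let f' := f.trans (FreeAlgebra.equivPolynomial K Y)
  let φ : Polynomial K →ₐ[K] Polynomial K :=
    (f' : C →ₐ[K] Polynomial K).comp ((Subalgebra.inclusion hAC).comp (e'.symm : _ →ₐ[K] A))
  have hφ : ∀ g, φ g = g.comp (φ Polynomial.X) := fun g => by
    rw [Polynomial.comp_eq_aeval]
    exact DFunLike.congr_fun (f := φ) (g := Polynomial.aeval (φ Polynomial.X)) (by ext; simp) g
  have hφA : ∀ a : A, φ (e' a) = f' (Subalgebra.inclusion hAC a) := fun a => by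
    simp [φ]
  obtain ⟨q, hq⟩ := Polynomial.exists_comp_eq_X (p := φ Polynomial.X) (c := f' ⟨n, hAC hn⟩)
    (by
      rw [map_ne_zero_iff f' f'.injective]
      exact fun h0 => hn0 (congrArg Subtype.val h0))
    fun F => ⟨e' ⟨f'.symm F * n, h _ (f'.symm F).2⟩, by
      rw [← hφ, hφA]
      apply f'.symm.injective
      rw [map_mul, AlgEquiv.symm_apply_apply, AlgEquiv.symm_apply_apply]
      rfl⟩
  obtain ⟨G, hG⟩ : ∃ G, φ G = f' ⟨r, hr⟩ := by
    refine ⟨(f' ⟨r, hr⟩).comp q, ?_⟩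
    rw [hφ, Polynomial.comp_assoc, hq, Polynomial.comp_X]
  have h1 := hφA (e'.symm G)
  rw [AlgEquiv.apply_symm_apply, hG] at h1
  have h2 : r = e'.symm G := congrArg Subtype.val (f'.injective h1)
  rw [h2]
  exact (e'.symm G).2

end FreeSubalgebra

section RigidCorrespondence

variable {K T : Type*} [Field K] [Ring T] [Algebra K T] [IsDomain T]
  {Γ : Type*} [Group Γ] [Fintype Γ] {α : Γ →* (T ≃ₐ[K] T)}

/-- The left-handed version of `exists_forall_mul_mem`. -/
theorem IsRigid.exists_forall_mem_mul [StarRing T]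
    (hstar : ∀ c : K, star (algebraMap K T c) = algebraMap K T c)
    (hαstar : ∀ g x, α g (star x) = star (α g x))
    (hT : IsRigid K T) (hα : Function.Injective α) {A : Subalgebra K T}
    (hA : ∀ x, galoisTrace α x ∈ A)
    (H : Subgroup Γ) (hH : ∀ g, g ∈ H ↔ ∀ a ∈ A, α g a = a) :
    ∃ c ∈ A, c ≠ 0 ∧ ∀ r, (∀ h ∈ H, α h r = r) → c * r ∈ A := by
  let A' : Subalgebra K T :=
    { carrier := {x | star x ∈ A}
      mul_mem' := fun {x y} hx hy => by
        rw [Set.mem_ofPred_eq, star_mul]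
        exact A.mul_mem hy hx
      add_mem' := fun {x y} hx hy => by
        rw [Set.mem_ofPred_eq, star_add]
        exact A.add_mem hx hy
      algebraMap_mem' := fun c => by
        rw [Set.mem_ofPred_eq, hstar]
        exact A.algebraMap_mem c }
  have hA' : ∀ x, galoisTrace α x ∈ A' := fun x => by
    have h1 := hA (star x)
    simp only [galoisTrace_apply, hαstar, ← star_sum] at h1
    rwa [← galoisTrace_apply] at h1
  obtain ⟨c, hc, hc0, h⟩ := exists_forall_mul_mem α (hT.separates_one α hα) hA'
    (fun g hg => hT.separates_galoisRestrict hα hA' hg) H fun g => by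
      rw [hH]
      refine ⟨fun h a ha => star_injective ?_, fun h a ha => star_injective ?_⟩
      · rw [← hαstar]
        exact h _ ha
      · rw [← hαstar]
        exact h _ (show star (star a) ∈ A by rwa [star_star])
  refine ⟨star c, hc, star_ne_zero.2 hc0, fun r hr => ?_⟩
  have h1 : star (star r * c) ∈ A := h (star r) fun g hg => by rw [hαstar, hr g hg]
  rwa [star_mul, star_star] at h1

/-- A free subalgebra containing all traces contains the invariants of its pointwise
stabilizer. -/
theorem IsRigid.le_of_free [StarRing T]
    (hstar : ∀ c : K, star (algebraMap K T c) = algebraMap K T c)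
    (hαstar : ∀ g x, α g (star x) = star (α g x))
    (hT : IsRigid K T) (hα : Function.Injective α) {A C : Subalgebra K T}
    (hA : ∀ x, galoisTrace α x ∈ A) {X : Type*} (e : A ≃ₐ[K] FreeAlgebra K X)
    (H : Subgroup Γ) (hH : ∀ g, g ∈ H ↔ ∀ a ∈ A, α g a = a)
    (hC : ∀ r, r ∈ C ↔ ∀ h ∈ H, α h r = r) : C ≤ A := by
  have : Nontrivial X := by
    by_contra hX
    rw [not_nontrivial_iff_subsingleton] at hX
    obtain ⟨a, ha, b, hb, hab⟩ := hT.exists_mul_ne_mul hα hA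
    have h1 := e.injective (a₁ := ⟨a, ha⟩ * ⟨b, hb⟩) (a₂ := ⟨b, hb⟩ * ⟨a, ha⟩) (by
      rw [map_mul, map_mul, FreeAlgebra.mul_comm_of_subsingleton])
    exact hab (congrArg Subtype.val h1)
  obtain ⟨n, hn, hn0, h⟩ := exists_forall_mul_mem α (hT.separates_one α hα) hA
    (fun g hg => hT.separates_galoisRestrict hα hA hg) H hH
  obtain ⟨n', hn', hn0', h'⟩ := hT.exists_forall_mem_mul hstar hαstar hα hA H hH
  exact Subalgebra.le_of_free_of_nontrivial e
    (fun a ha => (hC a).2 fun g hg => (hH g).1 hg a ha) hn hn0 hn' hn0'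
    (fun r hr => h r ((hC r).1 hr)) fun r hr => h' r ((hC r).1 hr)

end RigidCorrespondence

namespace FreeAlgebra

variable {K : Type*} [Field K] {V : Type*}

/-- The elements of the free algebra in which only words of length `n` occur. -/
def homogeneous (K V : Type*) [Field K] (n : ℕ) : Submodule K (FreeAlgebra K V) where
  carrier := {f | ∀ w, wordCoeff f w ≠ 0 → w.length = n}
  zero_mem' := by simp
  add_mem' {f g} hf hg w hw := by
    by_cases h : wordCoeff f w = 0
    · exact hg w (by simpa [h] using hw)
    · exact hf w h
  smul_mem' c f hf w hw := hf w (right_ne_zero_of_mul (by simpa using hw))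

theorem wordCoeff_eq_zero_of_mem_homogeneous {n : ℕ} {f : FreeAlgebra K V}
    (hf : f ∈ homogeneous K V n) {w : FreeMonoid V} (hw : w.length ≠ n) : wordCoeff f w = 0 := by
  by_contra h
  exact hw (hf w h)

theorem mul_mem_homogeneous {i j : ℕ} {f g : FreeAlgebra K V} (hf : f ∈ homogeneous K V i)
    (hg : g ∈ homogeneous K V j) : f * g ∈ homogeneous K V (i + j) := by
  intro w hw
  obtain ⟨a, b, rfl, ha, hb⟩ := exists_mul_of_wordCoeff_mul_ne_zero hw
  rw [FreeMonoid.length_mul, hf a ha, hg b hb]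

theorem word_mem_homogeneous (w : FreeMonoid V) :
    (word w : FreeAlgebra K V) ∈ homogeneous K V w.length := by
  classical
  intro v hv
  rw [wordCoeff_word, Finsupp.single_apply] at hv
  split_ifs at hv with h
  · rw [h]
  · exact absurd rfl hv

theorem eq_algebraMap_of_mem_homogeneous_zero {f : FreeAlgebra K V}
    (hf : f ∈ homogeneous K V 0) : f = algebraMap K _ (wordCoeff f 1) := by
  classical
  apply wordCoeff.injective
  rw [wordCoeff_algebraMap]
  ext w
  rw [Finsupp.single_apply]
  split_ifs with h
  · rw [h]
  · exact wordCoeff_eq_zero_of_mem_homogeneous hf fun hw => h (FreeMonoid.length_eq_zero.1 hw).symm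

theorem finite_homogeneous [Finite V] (n : ℕ) : Module.Finite K (homogeneous K V n) := by
  have hfin : {w : FreeMonoid V | w.length = n}.Finite := List.finite_length_eq V n
  have : Finite {w : FreeMonoid V | w.length = n} := hfin
  let φ : homogeneous K V n →ₗ[K] ({w : FreeMonoid V | w.length = n} → K) :=
    LinearMap.pi fun w => Finsupp.lapply w.1 ∘ₗ wordCoeff.toLinearMap ∘ₗ Submodule.subtype _
  refine Module.Finite.of_injective φ ((injective_iff_map_eq_zero φ).2 fun f hf => ?_)
  ext
  apply wordCoeff.injective
  ext w
  by_cases hw : w.length = n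
  · simpa [φ] using congrFun hf ⟨w, hw⟩
  · rw [wordCoeff_eq_zero_of_mem_homogeneous f.2 hw]
    simp

/-- The homogeneous component of degree `n`. -/
noncomputable def homogeneousComponent (n : ℕ) : FreeAlgebra K V →ₗ[K] FreeAlgebra K V :=
  wordCoeff.symm.toLinearMap ∘ₗ
    { toFun := Finsupp.filter fun w => w.length = n
      map_add' := fun _ _ => Finsupp.filter_add
      map_smul' := fun _ _ => Finsupp.filter_smul } ∘ₗ wordCoeff.toLinearMap

theorem wordCoeff_homogeneousComponent (n : ℕ) (f : FreeAlgebra K V) (w : FreeMonoid V) :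
    wordCoeff (homogeneousComponent n f) w = if w.length = n then wordCoeff f w else 0 := by
  simp [homogeneousComponent, Finsupp.filter_apply]

theorem homogeneousComponent_mem (n : ℕ) (f : FreeAlgebra K V) :
    homogeneousComponent n f ∈ homogeneous K V n := by
  intro w hw
  rw [wordCoeff_homogeneousComponent] at hw
  by_contra h
  simp [h] at hw

theorem homogeneousComponent_of_mem {n k : ℕ} {f : FreeAlgebra K V} (hf : f ∈ homogeneous K V k) :
    homogeneousComponent n f = if k = n then f else 0 := by
  apply wordCoeff.injective
  ext w
  rw [wordCoeff_homogeneousComponent]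
  by_cases hw : w.length = k
  · rw [hw]
    split_ifs <;> simp
  · have := wordCoeff_eq_zero_of_mem_homogeneous hf hw
    split_ifs <;> simp [this]

theorem exists_sum_homogeneousComponent (f : FreeAlgebra K V) :
    ∃ s : Finset ℕ, f = ∑ n ∈ s, homogeneousComponent n f := by
  classical
  refine ⟨(wordCoeff f).support.image FreeMonoid.length, wordCoeff.injective ?_⟩
  ext w
  rw [map_sum, Finsupp.finsetSum_apply]
  simp only [wordCoeff_homogeneousComponent, Finset.sum_ite_eq]
  split_ifs with h
  · rfl
  · by_contra hw
    exact h (Finset.mem_image_of_mem _ (Finsupp.mem_support_iff.2 hw))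

/-- Strip the suffix `w` from every word, discarding the words which do not end with `w`. -/
noncomputable def rightQuotient (w : FreeMonoid V) : FreeAlgebra K V →ₗ[K] FreeAlgebra K V :=
  wordCoeff.symm.toLinearMap ∘ₗ
    Finsupp.lcomapDomain (· * w) (mul_left_injective w) ∘ₗ wordCoeff.toLinearMap

theorem wordCoeff_rightQuotient (w : FreeMonoid V) (f : FreeAlgebra K V) (v : FreeMonoid V) :
    wordCoeff (rightQuotient w f) v = wordCoeff f (v * w) := by
  simp [rightQuotient, Finsupp.lcomapDomain]

theorem wordCoeff_mul_mul_of_mem_homogeneous {d : ℕ} {b f : FreeAlgebra K V}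
    (hb : b ∈ homogeneous K V d) {v w : FreeMonoid V} (hv : v.length = d) :
    wordCoeff (b * f) (v * w) = wordCoeff b v * wordCoeff f w :=
  wordCoeff_mul_mul fun a _ ha _ _ => (hb a ha).trans hv.symm

theorem homogeneousComponent_rightQuotient_mul {d n : ℕ} {b f : FreeAlgebra K V}
    (hb : b ∈ homogeneous K V d) (hd : d ≤ n) (w : FreeMonoid V) :
    homogeneousComponent n (rightQuotient w (b * f)) =
      b * homogeneousComponent (n - d) (rightQuotient w f) := by
  apply wordCoeff.injective
  ext v
  by_cases hv : v.length = n
  · obtain ⟨v₁, v₂, rfl, hv₁⟩ := v.exists_eq_mul_of_le_length (hd.trans hv.ge)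
    rw [FreeMonoid.length_mul] at hv
    rw [wordCoeff_homogeneousComponent, wordCoeff_rightQuotient, mul_assoc,
      wordCoeff_mul_mul_of_mem_homogeneous hb hv₁, wordCoeff_mul_mul_of_mem_homogeneous hb hv₁,
      wordCoeff_homogeneousComponent, wordCoeff_rightQuotient, FreeMonoid.length_mul,
      if_pos hv, if_pos (by omega)]
  · rw [wordCoeff_eq_zero_of_mem_homogeneous (homogeneousComponent_mem _ _) hv]
    have h := mul_mem_homogeneous hb
      (homogeneousComponent_mem (n - d) (rightQuotient w f))
    rw [Nat.add_sub_cancel' hd] at h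
    rw [wordCoeff_eq_zero_of_mem_homogeneous h hv]

/-- Every element of the free algebra is a scalar plus a right combination of the generators. -/
theorem exists_eq_algebraMap_add_sum {n : ℕ} {f : FreeAlgebra K V} (hf : LengthLE f (n + 1)) :
    ∃ (c : K) (g : V →₀ FreeAlgebra K V), (∀ x, LengthLE (g x) n) ∧
      f = algebraMap K _ c + g.sum fun x h => ι K x * h := by
  classical
  rw [← sum_wordCoeff f]
  refine Finset.sum_induction _ (fun f => ∃ (c : K) (g : V →₀ FreeAlgebra K V),
    (∀ x, LengthLE (g x) n) ∧ f = algebraMap K _ c + g.sum fun x h => ι K x * h) ?_ ?_ ?_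
  · rintro _ _ ⟨c, g, hg, rfl⟩ ⟨c', g', hg', rfl⟩
    refine ⟨c + c', g + g', fun x w hw => ?_, ?_⟩
    · by_cases h : wordCoeff (g x) w = 0
      · exact hg' x w (by simpa [h] using hw)
      · exact hg x w h
    · rw [Finsupp.sum_add_index' (by simp) (by simp [mul_add]), map_add]
      abel
  · exact ⟨0, 0, fun x w hw => by simp at hw, by simp⟩
  · intro w hw
    have hlen := hf w (Finsupp.mem_support_iff.1 hw)
    induction w using FreeMonoid.casesOn with
    | one => exact ⟨wordCoeff f 1, 0, fun x w hw => by simp at hw,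
        by simp [Algebra.algebraMap_eq_smul_one]⟩
    | of_mul x w =>
      rw [FreeMonoid.length_mul, FreeMonoid.length_of, add_comm, add_le_add_iff_right] at hlen
      refine ⟨0, Finsupp.single x (wordCoeff f (FreeMonoid.of x * w) • word w),
        fun y v hv => ?_, ?_⟩
      · rw [Finsupp.single_apply] at hv
        split_ifs at hv with hxy
        · exact (lengthLE_word w v (by
            rw [map_smul] at hv
            exact right_ne_zero_of_mul hv)).trans hlen
        · simp at hv
      · rw [Finsupp.sum_single_index (mul_zero _), map_zero, zero_add, mul_smul_comm]
        rw [← word_of, ← word_mul]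

end FreeAlgebra

namespace FreeAlgebra

variable {K : Type*} [Field K] {V : Type*}

/-- The span of the products of two homogeneous elements of `C` of positive degrees adding up to
`n`. -/
def decomposables (C : Subalgebra K (FreeAlgebra K V)) (n : ℕ) : Submodule K (FreeAlgebra K V) :=
  Submodule.span K {f | ∃ i j a b, 0 < i ∧ 0 < j ∧ i + j = n ∧
    (a ∈ C ∧ a ∈ homogeneous K V i) ∧ (b ∈ C ∧ b ∈ homogeneous K V j) ∧ f = a * b}

/-- The family `b` consists of homogeneous elements of `C` of degrees `d`, and induces in every
positive degree a basis of `C` modulo decomposable elements. -/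
structure IsMinimalGeneratingFamily (C : Subalgebra K (FreeAlgebra K V)) {X : Type*} (d : X → ℕ)
    (b : X → FreeAlgebra K V) : Prop where
  pos : ∀ x, 0 < d x
  mem : ∀ x, b x ∈ C
  isHomogeneous : ∀ x, b x ∈ homogeneous K V (d x)
  eq_zero : ∀ n, ∀ τ ∈ Finsupp.supported K K {x | d x = n},
    Finsupp.linearCombination K b τ ∈ decomposables C n → τ = 0
  mem_sup : ∀ n, 0 < n → ∀ f ∈ C, f ∈ homogeneous K V n →
    f ∈ Submodule.span K (Set.range b) ⊔ decomposables C n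

theorem exists_isMinimalGeneratingFamily [Finite V] (C : Subalgebra K (FreeAlgebra K V)) :
    ∃ (X : Type) (d : X → ℕ) (b : X → FreeAlgebra K V), IsMinimalGeneratingFamily C d b := by
  have hle : ∀ n, decomposables C n ≤ Subalgebra.toSubmodule C ⊓ homogeneous K V n := fun n => by
    refine Submodule.span_le.2 ?_
    rintro _ ⟨i, j, a, b, -, -, rfl, ha, hb, rfl⟩
    exact ⟨C.mul_mem ha.1 hb.1, mul_mem_homogeneous ha.2 hb.2⟩
  choose U' hU' using fun n => (decomposables C n).exists_isCompl
  let U : ℕ → Submodule K (FreeAlgebra K V) := fun n =>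
    U' n ⊓ (Subalgebra.toSubmodule C ⊓ homogeneous K V n)
  have hU : ∀ n, decomposables C n ⊔ U n = Subalgebra.toSubmodule C ⊓ homogeneous K V n := fun n =>
    by rw [← sup_inf_assoc_of_le _ (hle n), (hU' n).sup_eq_top, top_inf_eq]
  have hfin : ∀ n, Module.Finite K (U n) := fun n => by
    have := finite_homogeneous (K := K) (V := V) n
    exact Submodule.finiteDimensional_of_le (inf_le_right.trans inf_le_right :
      U n ≤ homogeneous K V n)
  let B := fun n => Module.finBasis K (U n)
  have hB : ∀ n i, (B n i : FreeAlgebra K V) ∈ U n := fun n i => (B n i).2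
  refine ⟨Σ n : ℕ, Fin (Module.finrank K (U (n + 1))), fun x => x.1 + 1,
    fun x => B (x.1 + 1) x.2, fun x => Nat.succ_pos _, fun x => (hB _ _).2.1,
    fun x => (hB _ _).2.2, ?_, ?_⟩
  · intro n τ hτ hdec
    have hmem : Finsupp.linearCombination K (fun x : Σ n : ℕ, Fin (Module.finrank K (U (n + 1))) =>
        (B (x.1 + 1) x.2 : FreeAlgebra K V)) τ ∈ U n := by
      rw [Finsupp.linearCombination_apply]
      refine Submodule.sum_mem _ fun x hx => Submodule.smul_mem _ _ ?_
      have h1 : x.1 + 1 = n := hτ hx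
      rw [← h1]
      exact hB _ _
    have hzero := Submodule.disjoint_def.1 (hU' n).disjoint _ hdec hmem.1
    rcases n with - | n
    · ext x
      by_contra hx
      exact Nat.succ_ne_zero _ (hτ (Finsupp.mem_support_iff.2 hx))
    · have hli := (linearIndepOn_range_iff (sigma_mk_injective (i := n)
        (β := fun n => Fin (Module.finrank K (U (n + 1)))))
        fun x => (B (x.1 + 1) x.2 : FreeAlgebra K V)).2
        ((B (n + 1)).linearIndependent.map' (U (n + 1)).subtype (Submodule.ker_subtype _))
      refine linearIndepOn_iff.1 hli τ (fun x hx => ?_) hzero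
      obtain ⟨k, i⟩ := x
      obtain rfl : k = n := Nat.succ_injective (hτ hx)
      exact ⟨i, rfl⟩
  · intro n hn f hfC hfn
    obtain ⟨n, rfl⟩ := Nat.exists_eq_succ_of_ne_zero hn.ne'
    have hf : f ∈ decomposables C (n + 1) ⊔ U (n + 1) := by
      rw [hU]
      exact ⟨hfC, hfn⟩
    rw [sup_comm] at hf
    refine (sup_le_sup_right ?_ _ : U (n + 1) ⊔ decomposables C (n + 1) ≤ _) hf
    rw [← Submodule.range_subtype (U (n + 1)), ← Submodule.map_top, ← (B (n + 1)).span_eq,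
      Submodule.map_span, ← Set.range_comp]
    refine Submodule.span_mono ?_
    rintro _ ⟨i, rfl⟩
    exact ⟨⟨n, i⟩, rfl⟩

variable {C : Subalgebra K (FreeAlgebra K V)} {X : Type*} {d : X → ℕ} {b : X → FreeAlgebra K V}

theorem IsMinimalGeneratingFamily.le_range_lift (h : IsMinimalGeneratingFamily C d b)
    (hC : ∀ f ∈ C, ∀ n, homogeneousComponent n f ∈ C) : C ≤ (lift K b).range := by
  have key : ∀ n, ∀ f ∈ C, f ∈ homogeneous K V n → f ∈ (lift K b).range := by
    intro n
    induction n using Nat.strong_induction_on with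
    | _ n ih =>
      intro f hfC hfn
      rcases n.eq_zero_or_pos with rfl | hn
      · rw [eq_algebraMap_of_mem_homogeneous_zero hfn]
        exact Subalgebra.algebraMap_mem _ _
      · have hle : Submodule.span K (Set.range b) ⊔ decomposables C n ≤
            Subalgebra.toSubmodule (lift K b).range := by
          refine sup_le (Submodule.span_le.2 ?_) (Submodule.span_le.2 ?_)
          · rintro _ ⟨x, rfl⟩
            exact ⟨ι K x, lift_ι_apply _ _⟩
          · rintro _ ⟨i, j, p, q, hi, hj, rfl, hp, hq, rfl⟩
            exact Subalgebra.mul_mem _ (ih i (by omega) p hp.1 hp.2) (ih j (by omega) q hq.1 hq.2)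
        exact hle (h.mem_sup n hn f hfC hfn)
  intro f hf
  obtain ⟨s, hs⟩ := exists_sum_homogeneousComponent f
  rw [hs]
  exact Subalgebra.sum_mem _ fun n _ => key n _ (hC f hf n) (homogeneousComponent_mem n f)

/-- If `C` is a direct summand as a left `C`-module through a graded projection, minimal generators
of `C` are independent over the free algebra, with coefficients on the right. -/
theorem IsMinimalGeneratingFamily.eq_zero_of_sum_mul (h : IsMinimalGeneratingFamily C d b)
    (R : FreeAlgebra K V →ₗ[K] FreeAlgebra K V) (hRC : ∀ f, R f ∈ C) (hR : ∀ f ∈ C, R f = f)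
    (hRmul : ∀ p ∈ C, ∀ f, R (p * f) = p * R f)
    (hRhom : ∀ n, ∀ f ∈ homogeneous K V n, R f ∈ homogeneous K V n)
    {c : X →₀ FreeAlgebra K V} (hc : (c.sum fun x f => b x * f) = 0) : c = 0 := by
  classical
  by_contra hc0
  -- the pairs of a generator and a word occurring in its coefficient
  let P : Finset (Σ _ : X, FreeMonoid V) := c.support.sigma fun x => (wordCoeff (c x)).support
  have hP : ∀ x w, ⟨x, w⟩ ∈ P ↔ wordCoeff (c x) w ≠ 0 := fun x w => by
    simp only [P, Finset.mem_sigma, Finsupp.mem_support_iff, and_iff_right_iff_imp]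
    rintro hw h0
    simp [h0] at hw
  have hPne : P.Nonempty := by
    obtain ⟨x, hx⟩ := Finsupp.support_nonempty_iff.2 hc0
    obtain ⟨w, hw, -⟩ := exists_lengthLE_of_ne_zero (Finsupp.mem_support_iff.1 hx)
    exact ⟨⟨x, w⟩, (hP x w).2 hw⟩
  obtain ⟨⟨k, w⟩, hkw, hmax⟩ := P.exists_max_image
    (fun p => toLex (d p.1 + p.2.length, d p.1)) hPne
  have hmax' : ∀ x v, wordCoeff (c x) v ≠ 0 → d x + v.length = d k + w.length → d x ≤ d k := by
    intro x v hv hlen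
    have h1 := hmax ⟨x, v⟩ ((hP x v).2 hv)
    rw [Prod.Lex.toLex_le_toLex] at h1
    simp only [hlen, lt_self_iff_false, false_or, true_and] at h1
    exact h1
  let t : X → FreeAlgebra K V := fun x =>
    if d x ≤ d k then homogeneousComponent (d k - d x) (rightQuotient w (c x)) else 0
  have hterm : ∀ x, homogeneousComponent (d k) (rightQuotient w (b x * c x)) = b x * t x := by
    intro x
    by_cases hx : d x ≤ d k
    · simp only [t, if_pos hx]
      exact homogeneousComponent_rightQuotient_mul (h.isHomogeneous x) hx w
    · simp only [t, if_neg hx, mul_zero]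
      apply wordCoeff.injective
      ext v
      rw [wordCoeff_homogeneousComponent, wordCoeff_rightQuotient, map_zero, Finsupp.zero_apply]
      split_ifs with hv
      · by_contra hne
        obtain ⟨u, v', huv, hu, hv'⟩ := exists_mul_of_wordCoeff_mul_ne_zero hne
        have hlen := congrArg FreeMonoid.length huv
        rw [FreeMonoid.length_mul, FreeMonoid.length_mul, h.isHomogeneous x u hu, hv] at hlen
        exact hx (hmax' x v' hv' hlen)
      · rfl
  have hsum : ∑ x ∈ c.support, b x * R (t x) = 0 := by
    have h1 := congrArg (R ∘ₗ homogeneousComponent (d k) ∘ₗ rightQuotient w) hc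
    simpa only [Finsupp.sum, map_sum, LinearMap.comp_apply, hterm, hRmul _ (h.mem _), map_zero]
      using h1
  let τ : X →₀ K := (c.mapRange (fun f => wordCoeff f w) (by simp)).filter fun x => d x = d k
  have hτk : τ k ≠ 0 := by
    simpa [τ] using (hP k w).1 hkw
  have hτ : Finsupp.linearCombination K b τ =
      ∑ x ∈ c.support, if d x = d k then wordCoeff (c x) w • b x else 0 := by
    rw [Finsupp.linearCombination_apply, Finsupp.sum_of_support_subset (s := c.support)]
    · refine Finset.sum_congr rfl fun x _ => ?_
      by_cases hx : d x = d k <;> simp [τ, hx]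
    · intro x hx
      rw [Finsupp.mem_support_iff] at hx ⊢
      rintro h0
      simp [τ, Finsupp.filter_apply, h0] at hx
    · simp
  refine hτk (DFunLike.congr_fun (h.eq_zero (d k) τ ?_ ?_) k)
  · intro x hx
    by_contra hne
    simp only [Set.mem_ofPred_eq] at hne
    simp [τ, hne] at hx
  · have hscal : ∀ x, d x = d k → b x * R (t x) = wordCoeff (c x) w • b x := by
      intro x hx
      simp only [t, hx, le_refl, if_true, Nat.sub_self]
      rw [eq_algebraMap_of_mem_homogeneous_zero (homogeneousComponent_mem 0 _),
        hR _ (C.algebraMap_mem _), wordCoeff_homogeneousComponent, wordCoeff_rightQuotient,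
        one_mul, if_pos FreeMonoid.length_one, ← Algebra.commutes, Algebra.smul_def]
    have hsplit : Finsupp.linearCombination K b τ =
        -∑ x ∈ c.support, if d x = d k then 0 else b x * R (t x) := by
      rw [hτ, eq_neg_iff_add_eq_zero, ← Finset.sum_add_distrib]
      refine (Finset.sum_congr rfl fun x _ => ?_).trans hsum
      split_ifs with hx
      · rw [hscal x hx, add_zero]
      · rw [zero_add]
    rw [hsplit]
    refine Submodule.neg_mem _ (Submodule.sum_mem _ fun x _ => ?_)
    split_ifs with hx
    · exact Submodule.zero_mem _
    by_cases hlt : d x ≤ d k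
    · refine Submodule.subset_span ⟨d x, d k - d x, b x, R (t x), h.pos x, by omega, by omega,
        ⟨h.mem x, h.isHomogeneous x⟩, ⟨hRC _, hRhom _ _ ?_⟩, rfl⟩
      simp only [t, if_pos hlt]
      exact homogeneousComponent_mem _ _
    · simp only [t, if_neg hlt, map_zero, mul_zero]
      exact Submodule.zero_mem _

theorem IsMinimalGeneratingFamily.lift_injective (h : IsMinimalGeneratingFamily C d b)
    (hb : ∀ c : X →₀ FreeAlgebra K V, (c.sum fun x f => b x * f) = 0 → c = 0) :
    Function.Injective (lift K b) := by
  have hcoeff : ∀ x f, wordCoeff (b x * f) 1 = 0 := fun x f => by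
    by_contra hne
    obtain ⟨u, v, huv, hu, -⟩ := exists_mul_of_wordCoeff_mul_ne_zero hne
    have h1 := congrArg FreeMonoid.length huv
    rw [FreeMonoid.length_mul, h.isHomogeneous x u hu, FreeMonoid.length_one] at h1
    have := h.pos x
    omega
  have key : ∀ n, ∀ f : FreeAlgebra K X, LengthLE f n → lift K b f = 0 → f = 0 := by
    intro n
    induction n with
    | zero =>
      intro f hf h0
      obtain ⟨c, rfl⟩ := eq_algebraMap_of_lengthLE_zero hf
      rw [AlgHom.commutes] at h0
      rw [(map_eq_zero_iff _ (algebraMap K _).injective).1 h0, map_zero]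
    | succ n ih =>
      intro f hf h0
      obtain ⟨c, g, hg, rfl⟩ := exists_eq_algebraMap_add_sum hf
      have h1 : algebraMap K (FreeAlgebra K V) c +
          (g.mapRange (lift K b) (map_zero _)).sum (fun x f => b x * f) = 0 := by
        rw [Finsupp.sum_mapRange_index (by simp)]
        simpa [Finsupp.sum] using h0
      have hc : c = 0 := by
        have h2 := DFunLike.congr_fun (congrArg wordCoeff h1) 1
        rw [map_add, wordCoeff_algebraMap, Finsupp.sum, map_sum, Finsupp.add_apply,
          Finsupp.finsetSum_apply, Finset.sum_eq_zero fun x _ => hcoeff x _] at h2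
        simpa using h2
      rw [hc, map_zero, zero_add] at h1
      have hg0 : g = 0 := by
        ext1 x
        exact ih _ (hg x) (by simpa using DFunLike.congr_fun (hb _ h1) x)
      rw [hc, hg0]
      simp
  refine (injective_iff_map_eq_zero _).2 fun f hf => ?_
  by_cases hf0 : f = 0
  · exact hf0
  obtain ⟨w, -, hw⟩ := exists_lengthLE_of_ne_zero hf0
  exact key _ f hw hf

/-- A subalgebra of a free algebra which is the image of a graded linear projection, linear over the
subalgebra on the left, is free. -/
theorem exists_algEquiv_of_projection [Finite V] (C : Subalgebra K (FreeAlgebra K V))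
    (R : FreeAlgebra K V →ₗ[K] FreeAlgebra K V) (hRC : ∀ f, R f ∈ C) (hR : ∀ f ∈ C, R f = f)
    (hRmul : ∀ p ∈ C, ∀ f, R (p * f) = p * R f)
    (hRhom : ∀ n, ∀ f ∈ homogeneous K V n, R f ∈ homogeneous K V n) :
    ∃ X : Type, Nonempty (C ≃ₐ[K] FreeAlgebra K X) := by
  obtain ⟨X, d, b, h⟩ := exists_isMinimalGeneratingFamily C
  have hC : ∀ f ∈ C, ∀ n, homogeneousComponent n f ∈ C := fun f hf n => by
    obtain ⟨s, hs⟩ := exists_sum_homogeneousComponent f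
    have h1 : homogeneousComponent n f = R (homogeneousComponent n f) := by
      conv_lhs => rw [← hR f hf, hs]
      rw [map_sum, map_sum]
      simp only [homogeneousComponent_of_mem (hRhom _ _ (homogeneousComponent_mem _ f)),
        Finset.sum_ite_eq']
      split_ifs with hn
      · rfl
      · have h2 := congrArg (homogeneousComponent n) hs
        rw [map_sum] at h2
        simp only [homogeneousComponent_of_mem (homogeneousComponent_mem _ f),
          Finset.sum_ite_eq', if_neg hn] at h2
        rw [h2, map_zero]
    rw [h1]
    exact hRC _
  have hrange : (lift K b).range = C := by
    refine le_antisymm ?_ (h.le_range_lift hC)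
    rw [← Algebra.adjoin_range_eq_range_freeAlgebra_lift]
    refine Algebra.adjoin_le ?_
    rintro _ ⟨x, rfl⟩
    exact h.mem x
  have hinj := h.lift_injective fun c hc => h.eq_zero_of_sum_mul R hRC hR hRmul hRhom hc
  exact ⟨X, ⟨((AlgEquiv.ofInjective _ hinj).trans (Subalgebra.equivOfEq _ _ hrange)).symm⟩⟩

end FreeAlgebra

section FreeAction

variable {K : Type*} [Field K] {m : ℕ}

theorem freeAct_ι (g : Matrix (Fin m) (Fin m) K) (j : Fin m) :
    freeAct K g (FreeAlgebra.ι K j) = ∑ i, g i j • FreeAlgebra.ι K i :=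
  FreeAlgebra.lift_ι_apply _ _

/-- Linear substitutions as a monoid homomorphism. -/
noncomputable def freeActHom (K : Type*) [Field K] (m : ℕ) :
    Matrix (Fin m) (Fin m) K →* (FreeAlgebra K (Fin m) →ₐ[K] FreeAlgebra K (Fin m)) where
  toFun := freeAct K
  map_one' := by
    ext j
    simp [freeAct_ι, Matrix.one_apply]
  map_mul' g h := by
    ext j
    simp only [Function.comp_apply, freeAct_ι, AlgHom.mul_apply, map_sum, map_smul,
      Matrix.mul_apply, Finset.sum_smul, Finset.smul_sum]
    rw [Finset.sum_comm]
    simp only [smul_smul, mul_comm]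

/-- The action of the general linear group by automorphisms. -/
noncomputable def freeActEquiv (K : Type*) [Field K] (m : ℕ) :
    GL (Fin m) K →* (FreeAlgebra K (Fin m) ≃ₐ[K] FreeAlgebra K (Fin m)) :=
  (AlgEquiv.algHomUnitsEquiv K _).toMonoidHom.comp (Units.map (freeActHom K m))

theorem freeActEquiv_apply (g : GL (Fin m) K) (f : FreeAlgebra K (Fin m)) :
    freeActEquiv K m g f = freeAct K (g : Matrix (Fin m) (Fin m) K) f := rfl

theorem freeActEquiv_injective : Function.Injective (freeActEquiv K m) := by
  classical
  intro g h hgh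
  ext i j
  have h1 := DFunLike.congr_fun hgh (FreeAlgebra.ι K j)
  rw [freeActEquiv_apply, freeActEquiv_apply, freeAct_ι, freeAct_ι] at h1
  have h2 := DFunLike.congr_fun (congrArg FreeAlgebra.wordCoeff h1) (FreeMonoid.of i)
  simpa [← FreeAlgebra.word_of, Finsupp.single_apply, FreeMonoid.of_injective.eq_iff] using h2

theorem star_smul_freeAlgebra {V : Type*} (c : K) (f : FreeAlgebra K V) :
    star (c • f) = c • star f := by
  rw [Algebra.smul_def, star_mul, FreeAlgebra.star_algebraMap, ← Algebra.commutes,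
    Algebra.smul_def]

theorem freeAct_star (g : Matrix (Fin m) (Fin m) K) (f : FreeAlgebra K (Fin m)) :
    freeAct K g (star f) = star (freeAct K g f) := by
  induction f using FreeAlgebra.induction with
  | grade0 r => simp only [AlgHom.commutes, FreeAlgebra.star_algebraMap]
  | grade1 j => simp only [FreeAlgebra.star_ι, freeAct_ι, star_sum, star_smul_freeAlgebra]
  | mul f f' hf hf' => simp only [star_mul, map_mul, hf, hf']
  | add f f' hf hf' => simp only [star_add, map_add, hf, hf']

theorem freeAct_mem_homogeneous (g : Matrix (Fin m) (Fin m) K) {n : ℕ} {f : FreeAlgebra K (Fin m)}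
    (hf : f ∈ FreeAlgebra.homogeneous K (Fin m) n) :
    freeAct K g f ∈ FreeAlgebra.homogeneous K (Fin m) n := by
  have key : ∀ w : FreeMonoid (Fin m),
      freeAct K g (FreeAlgebra.word w) ∈ FreeAlgebra.homogeneous K (Fin m) w.length := by
    intro w
    induction w using FreeMonoid.inductionOn' with
    | one =>
      rw [FreeAlgebra.word_one, map_one, ← FreeAlgebra.word_one]
      exact FreeAlgebra.word_mem_homogeneous 1
    | of_mul j w ih =>
      rw [FreeAlgebra.word_mul, map_mul, FreeMonoid.length_mul]
      refine FreeAlgebra.mul_mem_homogeneous ?_ ih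
      rw [FreeAlgebra.word_of, freeAct_ι]
      refine Submodule.sum_mem _ fun i _ => Submodule.smul_mem _ _ ?_
      rw [← FreeAlgebra.word_of]
      exact FreeAlgebra.word_mem_homogeneous (FreeMonoid.of i)
  rw [← FreeAlgebra.sum_wordCoeff f, Finsupp.sum, map_sum]
  refine Submodule.sum_mem _ fun w hw => ?_
  rw [map_smul, ← hf w (Finsupp.mem_support_iff.1 hw)]
  exact Submodule.smul_mem _ _ (key w)

theorem mem_freeInvariants {H : Subgroup (GL (Fin m) K)} {f : FreeAlgebra K (Fin m)} :
    f ∈ freeInvariants K H ↔ ∀ g ∈ H, freeActEquiv K m g f = f := by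
  simp [freeInvariants, Algebra.mem_iInf, freeActEquiv_apply, AlgHom.mem_equalizer]

/-- The invariants of a finite linear group form a free algebra. -/
theorem exists_algEquiv_freeInvariants [CharZero K] (H : Subgroup (GL (Fin m) K)) [Finite H] :
    ∃ X : Type, Nonempty (freeInvariants K H ≃ₐ[K] FreeAlgebra K X) := by
  cases nonempty_fintype H
  let α := (freeActEquiv K m).comp H.subtype
  have hcard : (Fintype.card H : K) ≠ 0 := Nat.cast_ne_zero.2 Fintype.card_ne_zero
  have hα : ∀ (h : H), ∀ f ∈ freeInvariants K H, α h f = f := fun h f hf =>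
    mem_freeInvariants.1 hf h h.2
  refine FreeAlgebra.exists_algEquiv_of_projection _ ((Fintype.card H : K)⁻¹ • galoisTrace α)
    (fun f => ?_) (fun f hf => ?_) (fun p hp f => ?_) fun n f hf => ?_
  · refine Subalgebra.smul_mem _ (mem_freeInvariants.2 fun g hg => ?_) _
    exact apply_galoisTrace α ⟨g, hg⟩ f
  · rw [LinearMap.smul_apply, galoisTrace_apply, Finset.sum_congr rfl fun h _ => hα h f hf,
      Finset.sum_const, Finset.card_univ, ← Nat.cast_smul_eq_nsmul K, inv_smul_smul₀ hcard]
  · simp only [LinearMap.smul_apply, galoisTrace_apply, map_mul, hα _ p hp, ← Finset.mul_sum,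
      mul_smul_comm]
  · rw [LinearMap.smul_apply, galoisTrace_apply]
    exact Submodule.smul_mem _ _ (Submodule.sum_mem _ fun h _ => freeAct_mem_homogeneous _ hf)

/-- Distinct linear substitutions are separated by two-sided multiplications. -/
theorem separates_freeActEquiv {Γ : Type*} [Group Γ] {ρ : Γ →* GL (Fin m) K}
    (hρ : Function.Injective ρ) (g : Γ) (hg : g ≠ 1) :
    Separates ((freeActEquiv K m).comp ρ 1 : FreeAlgebra K (Fin m) →ₐ[K] FreeAlgebra K (Fin m))
      ((freeActEquiv K m).comp ρ g : FreeAlgebra K (Fin m) →ₐ[K] FreeAlgebra K (Fin m)) := by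
  have hinj : Function.Injective ((freeActEquiv K m).comp ρ) := freeActEquiv_injective.comp hρ
  rcases subsingleton_or_nontrivial (Fin m) with hm | hm
  · refine Separates.of_commute FreeAlgebra.mul_comm_of_subsingleton fun h => hg (hinj ?_)
    ext f
    exact (DFunLike.congr_fun h f).symm
  · exact FreeAlgebra.isRigid.separates_one _ hinj g hg

theorem freeInvariants_le_of_free [CharZero K] (G : Subgroup (GL (Fin m) K)) [Fintype G]
    {A : Subalgebra K (FreeAlgebra K (Fin m))} (hGA : freeInvariants K G ≤ A) {X : Type*}
    (e : A ≃ₐ[K] FreeAlgebra K X) (H : Subgroup (GL (Fin m) K)) (hHG : H ≤ G)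
    (hH : ∀ g ∈ G, g ∈ H ↔ ∀ a ∈ A, freeActEquiv K m g a = a) : freeInvariants K H ≤ A := by
  let α := (freeActEquiv K m).comp G.subtype
  have hα : Function.Injective α := freeActEquiv_injective.comp G.subtype_injective
  have hA : ∀ x, galoisTrace α x ∈ A := fun x => hGA (mem_freeInvariants.2 fun g hg =>
    apply_galoisTrace α ⟨g, hg⟩ x)
  have hH' : ∀ g, g ∈ H.subgroupOf G ↔ ∀ a ∈ A, α g a = a := fun g => hH g g.2
  have hinv : ∀ r, r ∈ freeInvariants K H ↔ ∀ h ∈ H.subgroupOf G, α h r = r := fun r =>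
    mem_freeInvariants.trans
      ⟨fun h g hg => h g hg, fun h g hg => h ⟨g, hHG hg⟩ (Subgroup.mem_subgroupOf.2 hg)⟩
  rcases subsingleton_or_nontrivial (Fin m) with hm | hm
  · have hcomm := FreeAlgebra.mul_comm_of_subsingleton (K := K) (X := Fin m)
    have : Finite H := Finite.Set.subset (G : Set (GL (Fin m) K)) hHG
    obtain ⟨Y, ⟨f⟩⟩ := exists_algEquiv_freeInvariants H
    obtain ⟨n, hn, hn0, h⟩ := exists_forall_mul_mem α
      (separates_freeActEquiv G.subtype_injective) hA
      (fun g hg => Separates.of_commute hcomm hg) (H.subgroupOf G) hH'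
    exact Subalgebra.le_of_free_of_commute hcomm e f
      (fun a ha => (hinv a).2 fun g hg => (hH' g).1 hg a ha) hn hn0 fun r hr => h r ((hinv r).1 hr)
  · exact FreeAlgebra.isRigid.le_of_free FreeAlgebra.star_algebraMap
      (fun g x => freeAct_star _ x) hα hA e (H.subgroupOf G) hH' hinv

end FreeAction

/-- **Kharchenko's Galois correspondence.** For a finite subgroup `G ≤ GL_m(K)`, the map
`H ↦ K⟨x_1,…,x_m⟩^H` is a bijection between the subgroups of `G` and the free subalgebras of
`K⟨x_1,…,x_m⟩` containing `K⟨x_1,…,x_m⟩^G`. -/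
theorem kharchenko_galois_correspondence {K : Type*} [Field K] [IsAlgClosed K] [CharZero K]
    {m : ℕ} (G : Subgroup (GL (Fin m) K)) [Fintype G] :
    Set.BijOn (fun H : Subgroup (GL (Fin m) K) => freeInvariants K H)
      {H : Subgroup (GL (Fin m) K) | H ≤ G}
      {A : Subalgebra K (FreeAlgebra K (Fin m)) | freeInvariants K G ≤ A ∧
        ∃ X : Type, Nonempty (A ≃ₐ[K] FreeAlgebra K X)} := by
  refine ⟨fun H hH => ⟨fun f hf => ?_, ?_⟩, ?_, ?_⟩
  · exact mem_freeInvariants.2 fun g hg => mem_freeInvariants.1 hf g (hH hg)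
  · have : Finite H := Finite.Set.subset (G : Set (GL (Fin m) K)) hH
    exact exists_algEquiv_freeInvariants H
  · have key : ∀ H₁ ≤ G, ∀ H₂ ≤ G,
        freeInvariants K H₂ ≤ freeInvariants K H₁ → H₁ ≤ H₂ := by
      intro H₁ h₁ H₂ h₂ h g hg
      refine Subgroup.mem_subgroupOf.1 (mem_of_forall_invariant
        ((freeActEquiv K m).comp G.subtype) (separates_freeActEquiv G.subtype_injective)
        (H₂.subgroupOf G) (g := ⟨g, h₁ hg⟩) fun x hx => ?_)
      exact mem_freeInvariants.1 (h (mem_freeInvariants.2 fun k hk =>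
        hx ⟨k, h₂ hk⟩ (Subgroup.mem_subgroupOf.2 hk))) g hg
    exact fun H₁ h₁ H₂ h₂ h => le_antisymm (key H₁ h₁ H₂ h₂ h.ge) (key H₂ h₂ H₁ h₁ h.le)
  · rintro A ⟨hGA, X, ⟨e⟩⟩
    let H : Subgroup (GL (Fin m) K) :=
      { carrier := {g | g ∈ G ∧ ∀ a ∈ A, freeActEquiv K m g a = a}
        mul_mem' := fun {g h} hg hh => ⟨G.mul_mem hg.1 hh.1, fun a ha => by
          rw [map_mul, AlgEquiv.mul_apply, hh.2 a ha, hg.2 a ha]⟩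
        one_mem' := ⟨G.one_mem, fun a _ => by rw [map_one, AlgEquiv.one_apply]⟩
        inv_mem' := fun {g} hg => ⟨G.inv_mem hg.1, fun a ha => by
          nth_rw 1 [← hg.2 a ha]
          rw [← AlgEquiv.mul_apply, ← map_mul, inv_mul_cancel, map_one, AlgEquiv.one_apply]⟩ }
    refine ⟨H, fun g hg => hg.1, le_antisymm ?_ fun a ha => ?_⟩
    · exact freeInvariants_le_of_free G hGA e H (fun g hg => hg.1) fun g hg =>
        ⟨fun h => h.2, fun h => ⟨hg, h⟩⟩
    · exact mem_freeInvariants.2 fun g hg => hg.2 a ha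
end

section
/- (Sibirskii) Let C_{2m} be the algebra of invariants of m generic 2×2 matrices, i.e. the subalgebra of Ω = K[x_{pq}^{(i)} : 1 ≤ p,q ≤ 2, 1 ≤ i ≤ m] generated by the traces of all products of the generic matrices x_1,…,x_m. Then the polynomials tr(x_p) for 1 ≤ p ≤ m, tr(x_p x_q) for 1 ≤ p ≤ q ≤ m, and tr(x_p x_q x_r) for 1 ≤ p < q < r ≤ m generate C_{2m} as a K-algebra, and they form a minimal system of generators: no proper subset of this set generates C_{2m}. -/
open Matrix

variable (K : Type*) [Field K] [IsAlgClosed K] [CharZero K]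

/-- The `i`-th generic `2 × 2` matrix: the matrix over the polynomial algebra
`Ω = K[x_{pq}^{(i)}]` whose `(p,q)`-entry is the variable `x_{pq}^{(i)}`. -/
noncomputable def genericMatrix (m : ℕ) (i : Fin m) :
    Matrix (Fin 2) (Fin 2) (MvPolynomial (Fin m × Fin 2 × Fin 2) K) :=
  Matrix.of fun p q => MvPolynomial.X (i, p, q)

/-- The algebra `C_{2m}` of invariants of `m` generic `2 × 2` matrices: the subalgebra of `Ω`
generated by the traces of all products of the generic matrices. -/
noncomputable def matrixInvariants2 (m : ℕ) :
    Subalgebra K (MvPolynomial (Fin m × Fin 2 × Fin 2) K) :=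
  Algebra.adjoin K
    {x | ∃ l : List (Fin m), l ≠ [] ∧ x = Matrix.trace ((l.map (genericMatrix K m)).prod)}

/-- The Sibirskii generators of `C_{2m}`: `tr(x_p)`, `tr(x_p x_q)` for `p ≤ q`, and
`tr(x_p x_q x_r)` for `p < q < r`. -/
noncomputable def sibirskiiGenerators (m : ℕ) :
    Set (MvPolynomial (Fin m × Fin 2 × Fin 2) K) :=
  {f | (∃ p : Fin m, f = Matrix.trace (genericMatrix K m p)) ∨
    (∃ p q : Fin m, p ≤ q ∧ f = Matrix.trace (genericMatrix K m p * genericMatrix K m q)) ∨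
    (∃ p q r : Fin m, p < q ∧ q < r ∧
      f = Matrix.trace (genericMatrix K m p * genericMatrix K m q * genericMatrix K m r))}

section TraceIdentities

variable {R : Type*} [CommRing R]

/-- The fundamental trace identity of `2 × 2` matrices, in degree three. -/
theorem trace_mul_mul_add_trace_mul_mul_swap (a b c : Matrix (Fin 2) (Fin 2) R) :
    trace (a * b * c) + trace (a * c * b) =
      trace a * trace (b * c) + trace b * trace (a * c) + trace c * trace (a * b)
        - trace a * trace b * trace c := by
  simp only [trace_fin_two, mul_apply, Fin.sum_univ_two]
  ring

/-- Twice the trace of a product of four `2 × 2` matrices is a polynomial in traces of products of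
at most three of them. -/
theorem two_mul_trace_mul_mul_mul (a b c d : Matrix (Fin 2) (Fin 2) R) :
    2 * trace (a * b * c * d) =
      trace a * trace (b * c * d) + trace b * trace (a * c * d) + trace c * trace (a * b * d)
        + trace d * trace (a * b * c)
        + trace (a * b) * trace (c * d) - trace (a * c) * trace (b * d)
        + trace (a * d) * trace (b * c)
        - trace a * trace b * trace (c * d) - trace a * trace d * trace (b * c)
        - trace b * trace c * trace (a * d) - trace c * trace d * trace (a * b)
        + trace a * trace b * trace c * trace d := by
  simp only [trace_fin_two, mul_apply, Fin.sum_univ_two]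
  ring

end TraceIdentities

section Generation

variable {K : Type*} [Field K]

theorem Subalgebra.mem_of_two_mul_mem [CharZero K] {A : Type*} [CommRing A] [Algebra K A]
    (S : Subalgebra K A) {x : A} (h : 2 * x ∈ S) : x ∈ S := by
  have h2 : (2 : K)⁻¹ • (2 * x) = x := by
    rw [two_mul, ← two_smul K x, smul_smul, inv_mul_cancel₀ two_ne_zero, one_smul]
  exact h2 ▸ S.smul_mem h _

variable {m : ℕ}

theorem trace_genericMatrix_mem (p : Fin m) :
    trace (genericMatrix K m p) ∈ Algebra.adjoin K (sibirskiiGenerators K m) :=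
  Algebra.subset_adjoin (Or.inl ⟨p, rfl⟩)

theorem trace_genericMatrix_mul_mem (p q : Fin m) :
    trace (genericMatrix K m p * genericMatrix K m q) ∈
      Algebra.adjoin K (sibirskiiGenerators K m) := by
  rcases le_total p q with h | h
  · exact Algebra.subset_adjoin (Or.inr (Or.inl ⟨p, q, h, rfl⟩))
  · rw [trace_mul_comm]
    exact Algebra.subset_adjoin (Or.inr (Or.inl ⟨q, p, h, rfl⟩))

theorem trace_mul_mul_add_swap_mem (p q r : Fin m) :
    trace (genericMatrix K m p * genericMatrix K m q * genericMatrix K m r) +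
      trace (genericMatrix K m p * genericMatrix K m r * genericMatrix K m q) ∈
      Algebra.adjoin K (sibirskiiGenerators K m) := by
  rw [trace_mul_mul_add_trace_mul_mul_swap]
  have h1 := trace_genericMatrix_mem (K := K) (m := m)
  have h2 := trace_genericMatrix_mul_mem (K := K) (m := m)
  exact sub_mem (add_mem (add_mem (mul_mem (h1 _) (h2 _ _)) (mul_mem (h1 _) (h2 _ _)))
    (mul_mem (h1 _) (h2 _ _))) (mul_mem (mul_mem (h1 _) (h1 _)) (h1 _))

theorem trace_genericMatrix_mul_mul_mem [CharZero K] (p q r : Fin m) :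
    trace (genericMatrix K m p * genericMatrix K m q * genericMatrix K m r) ∈
      Algebra.adjoin K (sibirskiiGenerators K m) := by
  obtain ⟨t, ht⟩ : ∃ t : Fin m → Fin m → Fin m → MvPolynomial (Fin m × Fin 2 × Fin 2) K,
      ∀ p q r, t p q r =
        trace (genericMatrix K m p * genericMatrix K m q * genericMatrix K m r) :=
    ⟨_, fun _ _ _ => rfl⟩
  have cyc : ∀ p q r, t p q r = t r p q := fun p q r => by
    rw [ht, ht, trace_mul_cycle]
  have swap : ∀ p q r, t p q r + t p r q ∈ Algebra.adjoin K (sibirskiiGenerators K m) :=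
    fun p q r => by
      rw [ht, ht]
      exact trace_mul_mul_add_swap_mem p q r
  have sorted : ∀ p q r, p < q → q < r →
      t p q r ∈ Algebra.adjoin K (sibirskiiGenerators K m) := fun p q r hpq hqr =>
    Algebra.subset_adjoin (Or.inr (Or.inr ⟨p, q, r, hpq, hqr, ht p q r⟩))
  rw [← ht]
  generalize Algebra.adjoin K (sibirskiiGenerators K m) = S at *
  have eqCase : ∀ p q, t p q q ∈ S := fun p q =>
    S.mem_of_two_mul_mem (by rw [two_mul]; exact swap p q q)
  have swapMem : ∀ p q r, t p r q ∈ S → t p q r ∈ S := fun p q r h => by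
    simpa using sub_mem (swap p q r) h
  -- by cyclicity it suffices to treat a word starting with a least letter
  have minCase : ∀ p q r, p ≤ q → p ≤ r → t p q r ∈ S := fun p q r hpq hpr => by
    rcases hpq.eq_or_lt with rfl | hpq
    · rw [cyc]; exact eqCase _ _
    rcases hpr.eq_or_lt with rfl | hpr
    · rw [cyc, cyc]; exact eqCase _ _
    rcases lt_trichotomy q r with h | rfl | h
    · exact sorted _ _ _ hpq h
    · exact eqCase _ _
    · exact swapMem _ _ _ (sorted _ _ _ hpr h)
  rcases le_total p q with hpq | hqp
  · rcases le_total p r with hpr | hrp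
    · exact minCase _ _ _ hpq hpr
    · rw [cyc]; exact minCase _ _ _ hrp (hrp.trans hpq)
  · rcases le_total q r with hqr | hrq
    · rw [← cyc]; exact minCase _ _ _ hqr hqp
    · rw [cyc]; exact minCase _ _ _ (hrq.trans hqp) hrq

theorem trace_prod_genericMatrix_mem [CharZero K] (l : List (Fin m)) (hl : l ≠ []) :
    trace (l.map (genericMatrix K m)).prod ∈ Algebra.adjoin K (sibirskiiGenerators K m) := by
  induction hn : l.length using Nat.strong_induction_on generalizing l with
  | _ n ih =>
    match l, hl with
    | [p], _ => simpa using trace_genericMatrix_mem p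
    | [p, q], _ => simpa using trace_genericMatrix_mul_mem p q
    | [p, q, r], _ => simpa [mul_assoc] using trace_genericMatrix_mul_mul_mem (K := K) p q r
    | a :: b :: c :: d :: w, _ =>
      have mem : ∀ v : List (Fin m), v.length < 3 →
          trace ((v.map (genericMatrix K m)).prod *
            ((d :: w).map (genericMatrix K m)).prod) ∈
              Algebra.adjoin K (sibirskiiGenerators K m) := fun v hv => by
        rw [← List.prod_append, ← List.map_append]
        exact ih _ (by simp at hn ⊢; omega) (v ++ d :: w) (by simp) rfl
      set D := ((d :: w).map (genericMatrix K m)).prod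
      have hD : trace D ∈ Algebra.adjoin K (sibirskiiGenerators K m) := by simpa using mem [] (by simp)
      have hpD : ∀ p, trace (genericMatrix K m p * D) ∈
          Algebra.adjoin K (sibirskiiGenerators K m) := fun p => by
        simpa using mem [p] (by simp)
      have hpqD : ∀ p q, trace (genericMatrix K m p * genericMatrix K m q * D) ∈
          Algebra.adjoin K (sibirskiiGenerators K m) := fun p q => by
        simpa using mem [p, q] (by simp)
      have h1 := trace_genericMatrix_mem (K := K) (m := m)
      have h2 := trace_genericMatrix_mul_mem (K := K) (m := m)
      have h3 := trace_genericMatrix_mul_mul_mem (K := K) (m := m)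
      have hprod : ((a :: b :: c :: d :: w).map (genericMatrix K m)).prod =
          genericMatrix K m a * genericMatrix K m b * genericMatrix K m c * D := by
        simp [D, mul_assoc]
      rw [hprod]
      apply Subalgebra.mem_of_two_mul_mem
      rw [two_mul_trace_mul_mul_mul]
      clear_value D
      exact add_mem (sub_mem (sub_mem (sub_mem (sub_mem (add_mem (sub_mem (add_mem (add_mem
        (add_mem (add_mem (mul_mem (h1 _) (hpqD _ _)) (mul_mem (h1 _) (hpqD _ _)))
          (mul_mem (h1 _) (hpqD _ _))) (mul_mem hD (h3 _ _ _)))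
        (mul_mem (h2 _ _) (hpD _))) (mul_mem (h2 _ _) (hpD _))) (mul_mem (hpD _) (h2 _ _)))
        (mul_mem (mul_mem (h1 _) (h1 _)) (hpD _))) (mul_mem (mul_mem (h1 _) hD) (h2 _ _)))
        (mul_mem (mul_mem (h1 _) (h1 _)) (hpD _))) (mul_mem (mul_mem (h1 _) hD) (h2 _ _)))
        (mul_mem (mul_mem (mul_mem (h1 _) (h1 _)) (h1 _)) hD)

theorem adjoin_sibirskiiGenerators [CharZero K] :
    Algebra.adjoin K (sibirskiiGenerators K m) = matrixInvariants2 K m := by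
  apply le_antisymm
  · refine Algebra.adjoin_mono ?_
    rintro f (⟨p, rfl⟩ | ⟨p, q, -, rfl⟩ | ⟨p, q, r, -, -, rfl⟩)
    · exact ⟨[p], by simp, by simp⟩
    · exact ⟨[p, q], by simp, by simp⟩
    · exact ⟨[p, q, r], by simp, by simp [mul_assoc]⟩
  · refine Algebra.adjoin_le ?_
    rintro f ⟨l, hl, rfl⟩
    exact trace_prod_genericMatrix_mem l hl

end Generation

section Minimality

variable {K : Type*} [Field K] {m : ℕ}

/-- Evaluation of polynomials in the entries of `m` generic matrices at an `m`-tuple of matrices. -/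
noncomputable def evalMatrices (A : Fin m → Matrix (Fin 2) (Fin 2) K) :
    MvPolynomial (Fin m × Fin 2 × Fin 2) K →ₐ[K] K :=
  MvPolynomial.aeval fun v => A v.1 v.2.1 v.2.2

variable (A : Fin m → Matrix (Fin 2) (Fin 2) K)

theorem mapMatrix_evalMatrices_genericMatrix (p : Fin m) :
    (evalMatrices A).mapMatrix (genericMatrix K m p) = A p := by
  ext i j
  simp [evalMatrices, genericMatrix]

theorem evalMatrices_trace (M : Matrix (Fin 2) (Fin 2) (MvPolynomial (Fin m × Fin 2 × Fin 2) K)) :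
    evalMatrices A (trace M) = trace ((evalMatrices A).mapMatrix M) := by
  simp [trace_fin_two]

theorem evalMatrices_trace_genericMatrix (p : Fin m) :
    evalMatrices A (trace (genericMatrix K m p)) = trace (A p) := by
  rw [evalMatrices_trace, mapMatrix_evalMatrices_genericMatrix]

theorem evalMatrices_trace_mul (p q : Fin m) :
    evalMatrices A (trace (genericMatrix K m p * genericMatrix K m q)) = trace (A p * A q) := by
  simp only [evalMatrices_trace, map_mul, mapMatrix_evalMatrices_genericMatrix]

theorem evalMatrices_trace_mul_mul (p q r : Fin m) :
    evalMatrices A (trace (genericMatrix K m p * genericMatrix K m q * genericMatrix K m r)) =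
      trace (A p * A q * A r) := by
  simp only [evalMatrices_trace, map_mul, mapMatrix_evalMatrices_genericMatrix]

/-- For every generator there are two tuples of matrices at which all other generators agree,
while the given one takes different values. -/
theorem exists_evalMatrices_separating [CharZero K] {g : MvPolynomial (Fin m × Fin 2 × Fin 2) K}
    (hg : g ∈ sibirskiiGenerators K m) :
    ∃ A B : Fin m → Matrix (Fin 2) (Fin 2) K,
      evalMatrices A g ≠ evalMatrices B g ∧
        ∀ f ∈ sibirskiiGenerators K m, f ≠ g → evalMatrices A f = evalMatrices B f := by
  have h2 : (2 : K) ≠ -2 := fun h => by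
    have h4 : (4 : K) = 0 := by linear_combination h
    norm_num at h4
  rcases hg with ⟨p, rfl⟩ | ⟨p, q, hpq, rfl⟩ | ⟨p, q, r, hpq, hqr, rfl⟩
  · refine ⟨fun i => if i = p then 1 else 0, fun i => if i = p then -1 else 0, ?_, ?_⟩
    · simpa [evalMatrices_trace_genericMatrix] using h2
    · rintro f (⟨p', rfl⟩ | ⟨p', q', h, rfl⟩ | ⟨p', q', r', h, h', rfl⟩) hf
      · have : p' ≠ p := by rintro rfl; exact hf rfl
        simp [evalMatrices_trace_genericMatrix, this]
      · simp only [evalMatrices_trace_mul]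
        split_ifs <;> simp
      · simp only [evalMatrices_trace_mul_mul]
        have : p' ≠ p ∨ q' ≠ p := by grind
        rcases this with h | h <;> simp [h]
  · rcases hpq.eq_or_lt with rfl | hpq
    · refine ⟨fun i => if i = p then !![1, 0; 0, -1] else 0, fun _ => 0, ?_, ?_⟩
      · simp [evalMatrices_trace_mul, one_add_one_eq_two]
      · rintro f (⟨p', rfl⟩ | ⟨p', q', h, rfl⟩ | ⟨p', q', r', h, h', rfl⟩) hf
        · simp only [evalMatrices_trace_genericMatrix]
          split_ifs <;> simp
        · simp only [evalMatrices_trace_mul]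
          have : p' ≠ p ∨ q' ≠ p := by
            by_contra! hc
            exact hf (by rw [hc.1, hc.2])
          rcases this with h | h <;> simp [h]
        · simp only [evalMatrices_trace_mul_mul]
          have : p' ≠ p ∨ q' ≠ p := by grind
          rcases this with h | h <;> simp [h]
    · refine ⟨fun i => if i = p then !![1, 0; 0, -1] else if i = q then !![1, 0; 0, -1] else 0,
        fun i => if i = p then !![1, 0; 0, -1] else if i = q then !![-1, 0; 0, 1] else 0, ?_, ?_⟩
      · simp only [evalMatrices_trace_mul, if_neg hpq.ne', if_true]
        simp [trace_fin_two]
        intro h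
        exact h2 (by linear_combination h)
      · rintro f (⟨p', rfl⟩ | ⟨p', q', h, rfl⟩ | ⟨p', q', r', h, h', rfl⟩) hf
        · simp only [evalMatrices_trace_genericMatrix]
          split_ifs <;> simp
        · simp only [evalMatrices_trace_mul]
          have : ¬ (p' = p ∧ q' = q) := by
            rintro ⟨rfl, rfl⟩
            exact hf rfl
          split_ifs <;> first | (exfalso; grind) | simp
        · simp only [evalMatrices_trace_mul_mul]
          have : (p' ≠ p ∧ p' ≠ q) ∨ (q' ≠ p ∧ q' ≠ q) ∨ (r' ≠ p ∧ r' ≠ q) := by grind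
          rcases this with h | h | h <;> simp [h]
  · let A : Fin m → Matrix (Fin 2) (Fin 2) K := fun i =>
      if i = p then !![1, 0; 0, 0] else if i = q then !![0, 1; 0, 0] else
        if i = r then !![0, 0; 1, 0] else 0
    have hA : ∀ i, A i = 0 ∨ i = p ∨ i = q ∨ i = r := by grind
    refine ⟨A, fun i => (A i)ᵀ, ?_, ?_⟩
    · simp only [evalMatrices_trace_mul_mul, A, if_neg hpq.ne', if_neg hqr.ne',
        if_neg (hpq.trans hqr).ne', if_true]
      simp [trace_fin_two, mul_apply]
    · rintro f (⟨p', rfl⟩ | ⟨p', q', h, rfl⟩ | ⟨p', q', r', h, h', rfl⟩) hf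
      · simp [evalMatrices_trace_genericMatrix]
      · simp only [evalMatrices_trace_mul]
        rw [← transpose_mul, trace_transpose, trace_mul_comm]
      · simp only [evalMatrices_trace_mul_mul]
        have : ¬ (p' = p ∧ q' = q ∧ r' = r) := by
          rintro ⟨rfl, rfl, rfl⟩
          exact hf rfl
        have : A p' = 0 ∨ A q' = 0 ∨ A r' = 0 := by
          have := hA p'
          have := hA q'
          have := hA r'
          grind
        rcases this with h | h | h <;> simp [h]

theorem notMem_adjoin_of_subset_sibirskiiGenerators [CharZero K]
    {T : Set (MvPolynomial (Fin m × Fin 2 × Fin 2) K)} (hT : T ⊆ sibirskiiGenerators K m)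
    {g : MvPolynomial (Fin m × Fin 2 × Fin 2) K} (hg : g ∈ sibirskiiGenerators K m)
    (hgT : g ∉ T) : g ∉ Algebra.adjoin K T := by
  obtain ⟨A, B, hne, heq⟩ := exists_evalMatrices_separating hg
  intro hmem
  have hle : Algebra.adjoin K T ≤ AlgHom.equalizer (evalMatrices A) (evalMatrices B) :=
    Algebra.adjoin_le fun f hf => heq f (hT hf) fun h => hgT (h ▸ hf)
  exact hne (hle hmem)

end Minimality

/-- **Sibirskii.** The traces `tr(x_p)`, `tr(x_p x_q)` (`p ≤ q`) and `tr(x_p x_q x_r)`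
(`p < q < r`) form a minimal system of generators of the algebra `C_{2m}` of invariants of
`m` generic `2 × 2` matrices: they generate `C_{2m}`, and no proper subset of them does. -/
theorem sibirskii_minimal_generators (m : ℕ) :
    Algebra.adjoin K (sibirskiiGenerators K m) = matrixInvariants2 K m ∧
      ∀ T : Set (MvPolynomial (Fin m × Fin 2 × Fin 2) K),
        T ⊂ sibirskiiGenerators K m → Algebra.adjoin K T ≠ matrixInvariants2 K m := by
  refine ⟨adjoin_sibirskiiGenerators, fun T hT h => ?_⟩
  obtain ⟨g, hg, hgT⟩ := Set.exists_of_ssubset hT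
  refine notMem_adjoin_of_subset_sibirskiiGenerators hT.subset hg hgT ?_
  rw [h, ← adjoin_sibirskiiGenerators]
  exact Algebra.subset_adjoin hg
end
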